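/- arXiv:1512.07868 — 6 statements merged into one kernel-verified Lean document; each statement's English description precedes it below -/
import Mathlib

section
/- Let μ and ν be finite nonnegative Borel measures on ∂D, and write μ = f·ν + μ_s, where f ∈ L¹(ν) is nonnegative and μ_s is a nonnegative measure singular with respect to ν (Lebesgue decomposition). Set u(x) = ∫_{∂D} M(x,w) dμ(w) and v(x) = ∫_{∂D} M(x,w) dν(w) for x ∈ D. Fix β > 1 and a point z ∈ ∂D such that (i) ν(∂D ∩ B(z,r)) > 0 for all small r > 0 and lim_{r→0} [∫_{∂D ∩ B(z,r)} |f(w) − f(z)| dν(w) + μ_s(∂D ∩ B(z,r))] / ν(∂D ∩ B(z,r)) = 0, and (ii) δ_D(x)/v(x) → 0 as x → z with x ∈ A_z^β. Then u(x)/v(x) → f(z) as x → z with x ∈ A_z^β. -/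
open MeasureTheory Metric Filter Topology Set

lemma exists_setOf_lt_div_pow_eq_ball {E : Type*} [PseudoMetricSpace E] (z : E)
    {δ : ℝ} (hδ : 0 < δ) {d : ℕ} (hd : d ≠ 0)
    {t : ℝ} (ht : 0 < t) : ∃ r, {w | t < δ / (δ + dist w z) ^ d} = ball z r := by
  refine ⟨(δ / t) ^ ((d : ℝ)⁻¹) - δ, ?_⟩
  ext w
  have hs : 0 < δ + dist w z := by positivity
  have hρ : 0 ≤ (δ / t) ^ ((d : ℝ)⁻¹) := by positivity
  rw [mem_ofPred_eq, mem_ball, lt_sub_iff_add_lt', ← pow_lt_pow_iff_left₀ hs.le hρ hd,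
    Real.rpow_inv_natCast_pow (by positivity) hd, lt_div_iff₀ (by positivity),
    lt_div_iff₀ ht, mul_comm]

section RadialComparison

variable {E : Type*} [PseudoMetricSpace E] [MeasurableSpace E] [OpensMeasurableSpace E]

/-- If `κ` is dominated by `ε ν` on all balls of radius at most `R` around `z`, then the same holds
for the integrals over `ball z R` of functions whose superlevel sets are balls around `z`. -/
lemma setIntegral_ball_le_of_measure_ball_le {κ ν : Measure E} {z : E} {R ε : ℝ} (hε : 0 ≤ ε)
    (h : ∀ r ≤ R, κ (ball z r) ≤ ENNReal.ofReal ε * ν (ball z r))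
    {g : E → ℝ} (hg : Measurable g) (hg0 : ∀ w, 0 ≤ g w)
    (hball : ∀ t > 0, ∃ r, {w | t < g w} = ball z r) (hgν : IntegrableOn g (ball z R) ν) :
    ∫ w in ball z R, g w ∂κ ≤ ε * ∫ w in ball z R, g w ∂ν := by
  have key : ∫⁻ w in ball z R, ENNReal.ofReal (g w) ∂κ ≤
      ENNReal.ofReal ε * ∫⁻ w in ball z R, ENNReal.ofReal (g w) ∂ν := by
    rw [lintegral_eq_lintegral_meas_lt _ (ae_of_all _ hg0) hg.aemeasurable,
      lintegral_eq_lintegral_meas_lt _ (ae_of_all _ hg0) hg.aemeasurable,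
      ← lintegral_const_mul' _ _ ENNReal.ofReal_ne_top]
    refine setLIntegral_mono' measurableSet_Ioi fun t ht => ?_
    obtain ⟨r, hr⟩ := hball t ht
    have hmin : ball z r ∩ ball z R = ball z (min r R) := by
      ext w
      simp
    rw [hr, Measure.restrict_apply measurableSet_ball, Measure.restrict_apply measurableSet_ball,
      hmin]
    exact h _ (min_le_right _ _)
  rw [integral_eq_lintegral_of_nonneg_ae (ae_of_all _ hg0) hg.aestronglyMeasurable,
    integral_eq_lintegral_of_nonneg_ae (ae_of_all _ hg0) hg.aestronglyMeasurable,
    show ε = (ENNReal.ofReal ε).toReal from (ENNReal.toReal_ofReal hε).symm, ← ENNReal.toReal_mul]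
  refine ENNReal.toReal_mono (ENNReal.mul_ne_top ENNReal.ofReal_ne_top ?_) key
  exact hgν.lintegral_lt_top.ne

/-- If `κ ≤ ε ν` on small balls around `z`, then the integral of a kernel comparable to
`δ / (δ + dist w z) ^ d` against `κ` is at most a multiple of `ε` times its integral against `ν`,
up to an error of order `δ`. -/
lemma integral_kernel_le {κ ν : Measure E} [IsFiniteMeasure κ] [IsFiniteMeasure ν]
    {z : E} {R ε δ a b : ℝ} (hR : 0 < R) (hε : 0 ≤ ε) (hδ : 0 < δ) (ha : 0 < a) (hb : 0 ≤ b)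
    {d : ℕ} (hd : d ≠ 0) (h : ∀ r ≤ R, κ (ball z r) ≤ ENNReal.ofReal ε * ν (ball z r))
    {k : E → ℝ} (hkν : Integrable k ν) (hkκ : Integrable k κ)
    (hlow : ∀ᵐ w ∂ν, a * (δ / (δ + dist w z) ^ d) ≤ k w)
    (hup : ∀ᵐ w ∂κ, k w ≤ b * (δ / (δ + dist w z) ^ d)) :
    ∫ w, k w ∂κ ≤ b / a * ε * ∫ w, k w ∂ν + b * κ.real univ / R ^ d * δ := by
  set g : E → ℝ := fun w => δ / (δ + dist w z) ^ d with hg_def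
  have hg : Measurable g := by
    have : Continuous g := by
      refine continuous_const.div (by fun_prop) fun w => ?_
      have : 0 < δ + dist w z := by positivity
      positivity
    exact this.measurable
  have hg0 : ∀ w, 0 ≤ g w := fun w => by positivity
  have hgb : ∀ w, ‖g w‖ ≤ δ / δ ^ d := fun w => by
    rw [Real.norm_of_nonneg (hg0 w)]
    simp only [hg_def]
    gcongr
    exact le_add_of_nonneg_right dist_nonneg
  have hgi : ∀ (m : Measure E) [IsFiniteMeasure m], Integrable g m := fun m _ =>
    .of_bound hg.aestronglyMeasurable _ (ae_of_all _ hgb)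
  have hnear := setIntegral_ball_le_of_measure_ball_le hε h hg hg0
    (fun t ht => exists_setOf_lt_div_pow_eq_ball z hδ hd ht) (hgi ν).integrableOn
  have hν : a * ∫ w in ball z R, g w ∂ν ≤ ∫ w, k w ∂ν := by
    calc a * ∫ w in ball z R, g w ∂ν ≤ a * ∫ w, g w ∂ν := by
          exact mul_le_mul_of_nonneg_left
            (setIntegral_le_integral (hgi ν) (ae_of_all _ hg0)) ha.le
      _ = ∫ w, a * g w ∂ν := (integral_const_mul _ _).symm
      _ ≤ ∫ w, k w ∂ν := integral_mono_ae ((hgi ν).const_mul a) hkν hlow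
  have hfar : ∫ w in (ball z R)ᶜ, g w ∂κ ≤ κ.real univ * (δ / R ^ d) := by
    calc ∫ w in (ball z R)ᶜ, g w ∂κ ≤ ∫ w in (ball z R)ᶜ, δ / R ^ d ∂κ := by
          refine setIntegral_mono_on (hgi κ).integrableOn (integrable_const _)
            measurableSet_ball.compl fun w hw => ?_
          have hw' : R ≤ dist w z := not_lt.1 hw
          simp only [hg_def]
          gcongr
          linarith
      _ = κ.real (ball z R)ᶜ * (δ / R ^ d) := by simp [measureReal_def]
      _ ≤ κ.real univ * (δ / R ^ d) := by
          exact mul_le_mul_of_nonneg_right (measureReal_mono (subset_univ _)) (by positivity)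
  calc ∫ w, k w ∂κ ≤ ∫ w, b * g w ∂κ := integral_mono_ae hkκ ((hgi κ).const_mul b) hup
    _ = b * (∫ w in ball z R, g w ∂κ + ∫ w in (ball z R)ᶜ, g w ∂κ) := by
        rw [integral_const_mul, integral_add_compl measurableSet_ball (hgi κ)]
    _ ≤ b * (ε * ((∫ w, k w ∂ν) / a) + κ.real univ * (δ / R ^ d)) := by
        gcongr
        refine hnear.trans ?_
        gcongr
        rwa [le_div_iff₀ ha, mul_comm]
    _ = b / a * ε * ∫ w, k w ∂ν + b * κ.real univ / R ^ d * δ := by ring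

end RadialComparison

/-- The measure `|f - c| ν + μs` controls `∫ k d(f ν + μs) - c ∫ k dν`. -/
lemma abs_integral_sub_const_mul_le {E : Type*} [MeasurableSpace E]
    {ν μs : Measure E} {f k : E → ℝ} {c : ℝ}
    (hf0 : ∀ w, 0 ≤ f w) (hf : AEMeasurable f ν) (hk : Measurable k)
    (hkν : Integrable k ν) (hkμs : Integrable k μs)
    (hkf : Integrable (fun w => f w * k w) ν)
    (hk0ν : ∀ᵐ w ∂ν, 0 ≤ k w) (hk0μs : ∀ᵐ w ∂μs, 0 ≤ k w) :
    |∫ w, k w ∂(ν.withDensity (fun w => ENNReal.ofReal (f w)) + μs) - c * ∫ w, k w ∂ν| ≤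
      ∫ w, k w ∂(ν.withDensity (fun w => ENNReal.ofReal |f w - c|) + μs) := by
  have hfc : AEMeasurable (fun w => |f w - c|) ν := (hf.sub_const c).abs
  have hint : ∀ {p : E → ℝ}, (∀ w, 0 ≤ p w) → AEMeasurable p ν →
      Integrable (fun w => p w * k w) ν →
      Integrable k (ν.withDensity fun w => ENNReal.ofReal (p w)) ∧
      ∫ w, k w ∂(ν.withDensity fun w => ENNReal.ofReal (p w)) = ∫ w, p w * k w ∂ν := by
    intro p hp0 hp hpk
    constructor
    · rw [integrable_withDensity_iff_integrable_smul₀' hp.ennreal_ofReal (by simp)]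
      simpa [ENNReal.toReal_ofReal (hp0 _)] using hpk
    · rw [integral_withDensity_eq_integral_toReal_smul₀ hp.ennreal_ofReal (by simp)]
      simp [ENNReal.toReal_ofReal (hp0 _)]
  have hdiff : Integrable (fun w => (f w - c) * k w) ν := by
    simp only [sub_mul]
    exact hkf.sub (hkν.const_mul c)
  have habs : Integrable (fun w => |f w - c| * k w) ν := by
    refine hdiff.mono (hfc.mul hk.aemeasurable).aestronglyMeasurable (ae_of_all _ fun w => ?_)
    simp
  obtain ⟨h1, h2⟩ := hint hf0 hf hkf
  obtain ⟨h3, h4⟩ := hint (fun w => abs_nonneg (f w - c)) hfc habs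
  rw [integral_add_measure h1 hkμs, integral_add_measure h3 hkμs, h2, h4]
  have hsub : ∫ w, (f w - c) * k w ∂ν = ∫ w, f w * k w ∂ν - c * ∫ w, k w ∂ν := by
    rw [← integral_const_mul, ← integral_sub hkf (hkν.const_mul c)]
    simp only [sub_mul]
  calc _ = |∫ w, (f w - c) * k w ∂ν + ∫ w, k w ∂μs| := by rw [hsub]; ring_nf
    _ ≤ |∫ w, (f w - c) * k w ∂ν| + |∫ w, k w ∂μs| := abs_add_le _ _
    _ ≤ ∫ w, |f w - c| * k w ∂ν + ∫ w, k w ∂μs := by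
        gcongr
        · refine abs_integral_le_integral_abs.trans_eq (integral_congr_ae ?_)
          filter_upwards [hk0ν] with w hw
          rw [abs_mul, abs_of_nonneg hw]
        · rw [abs_of_nonneg (integral_nonneg_of_ae hk0μs)]

/-- Relative Fatou theorem at a fixed boundary point.
Let `D ⊂ ℝ^d` (`d ≥ 2`) be a bounded open set and `M` a Borel kernel satisfying the
Martin kernel estimate.  Let `μ = f·ν + μ_s` be the Lebesgue decomposition of a finite
measure `μ` on `∂D` with respect to a finite measure `ν` on `∂D`, and set
`u(x) = ∫_{∂D} M(x,w) dμ(w)`, `v(x) = ∫_{∂D} M(x,w) dν(w)`.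
If `z ∈ ∂D` is a point where the Lebesgue differentiation condition holds,
`ν(∂D ∩ B(z,r)) > 0` for all small `r > 0`, and `δ_D(x)/v(x) → 0` nontangentially
at `z`, then `u(x)/v(x) → f(z)` nontangentially at `z`. -/
theorem stmt_0
    (d : ℕ) (hd : 2 ≤ d)
    (D : Set (EuclideanSpace ℝ (Fin d)))
    (hD_open : IsOpen D) (hD_bdd : Bornology.IsBounded D)
    (M : EuclideanSpace ℝ (Fin d) → EuclideanSpace ℝ (Fin d) → ℝ)
    (hM_meas : ∀ x, Measurable fun w => M x w)
    (c₁ c₂ : ℝ) (hc₁ : 0 < c₁) (hc₁₂ : c₁ ≤ c₂)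
    (hM_lb : ∀ x ∈ D, ∀ w ∈ frontier D,
      c₁ * infDist x Dᶜ / dist x w ^ d ≤ M x w)
    (hM_ub : ∀ x ∈ D, ∀ w ∈ frontier D,
      M x w ≤ c₂ * infDist x Dᶜ / dist x w ^ d)
    (μ ν : Measure (EuclideanSpace ℝ (Fin d)))
    [IsFiniteMeasure μ] [IsFiniteMeasure ν]
    (hμ_supp : μ (frontier D)ᶜ = 0) (hν_supp : ν (frontier D)ᶜ = 0)
    (f : EuclideanSpace ℝ (Fin d) → ℝ) (hf_nonneg : ∀ w, 0 ≤ f w)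
    (hf_int : Integrable f ν)
    (μs : Measure (EuclideanSpace ℝ (Fin d))) [IsFiniteMeasure μs]
    (hμs_supp : μs (frontier D)ᶜ = 0)
    (hμs_sing : μs ⟂ₘ ν)
    (hdecomp : μ = ν.withDensity (fun w => ENNReal.ofReal (f w)) + μs)
    (u v : EuclideanSpace ℝ (Fin d) → ℝ)
    (hu : ∀ x, u x = ∫ w in frontier D, M x w ∂μ)
    (hv : ∀ x, v x = ∫ w in frontier D, M x w ∂ν)
    (β : ℝ) (hβ : 1 < β)
    (z : EuclideanSpace ℝ (Fin d)) (hz : z ∈ frontier D)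
    (hν_pos : ∃ r₀ > 0, ∀ r : ℝ, 0 < r → r ≤ r₀ →
      0 < ν (frontier D ∩ ball z r))
    (hLeb : Tendsto
      (fun r : ℝ => ((∫ w in frontier D ∩ ball z r, |f w - f z| ∂ν)
          + (μs (frontier D ∩ ball z r)).toReal)
        / (ν (frontier D ∩ ball z r)).toReal)
      (𝓝[>] (0 : ℝ)) (𝓝 0))
    (hδv : Tendsto (fun x => infDist x Dᶜ / v x)
      (𝓝[{x ∈ D | dist x z < β * infDist x Dᶜ}] z) (𝓝 0)) :
    Tendsto (fun x => u x / v x)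
      (𝓝[{x ∈ D | dist x z < β * infDist x Dᶜ}] z) (𝓝 (f z)) := by
  have hd0 : d ≠ 0 := by omega
  have hzD : ∀ w ∈ frontier D, w ∈ Dᶜ := fun w hw hwD =>
    (disjoint_frontier_iff_isOpen.2 hD_open).le_bot ⟨hw, hwD⟩
  have hν_ae : ∀ᵐ w ∂ν, w ∈ frontier D := hν_supp
  have hμs_ae : ∀ᵐ w ∂μs, w ∈ frontier D := hμs_supp
  have hμ_ae : ∀ᵐ w ∂μ, w ∈ frontier D := hμ_supp
  have hfrν : ∀ r, ν (frontier D ∩ ball z r) = ν (ball z r) := fun r =>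
    measure_congr (inter_ae_eq_right_of_ae_eq_univ (eventuallyEq_univ.2 hν_ae))
  set κ : Measure (EuclideanSpace ℝ (Fin d)) :=
    ν.withDensity (fun w => ENNReal.ofReal |f w - f z|) + μs with hκ_def
  have hfz : Integrable (fun w => |f w - f z|) ν := (hf_int.sub (integrable_const _)).abs
  have : IsFiniteMeasure (ν.withDensity fun w => ENNReal.ofReal |f w - f z|) :=
    isFiniteMeasure_withDensity_ofReal hfz.2
  have hκ_ae : ∀ᵐ w ∂κ, w ∈ frontier D :=
    ae_add_measure_iff.2 ⟨(withDensity_absolutelyContinuous _ _).ae_le hν_ae, hμs_ae⟩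
  have hκ_ball : ∀ r, κ (ball z r) = ENNReal.ofReal
      ((∫ w in frontier D ∩ ball z r, |f w - f z| ∂ν) + (μs (frontier D ∩ ball z r)).toReal) := by
    intro r
    have hset : (frontier D ∩ ball z r : Set _) =ᵐ[ν] ball z r :=
      inter_ae_eq_right_of_ae_eq_univ (eventuallyEq_univ.2 hν_ae)
    have hμsr : μs (frontier D ∩ ball z r) = μs (ball z r) :=
      measure_congr (inter_ae_eq_right_of_ae_eq_univ (eventuallyEq_univ.2 hμs_ae))
    rw [setIntegral_congr_set hset, hμsr, ENNReal.ofReal_add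
      (integral_nonneg fun _ => abs_nonneg _) ENNReal.toReal_nonneg,
      ENNReal.ofReal_toReal (measure_ne_top _ _),
      ofReal_integral_eq_lintegral_ofReal hfz.integrableOn (ae_of_all _ fun _ => abs_nonneg _),
      hκ_def, Measure.add_apply, withDensity_apply _ measurableSet_ball]
  set a : ℝ := c₁ / β ^ d
  set b : ℝ := c₂ * (2 + β) ^ d
  have hβ0 : 0 < β := by linarith
  have hc₂ : 0 < c₂ := hc₁.trans_le hc₁₂
  have ha : 0 < a := by positivity
  have hb : 0 < b := by positivity
  have hStolz : ∀ x ∈ {x ∈ D | dist x z < β * infDist x Dᶜ}, 0 < v x ∧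
      ∀ ε ≥ 0, ∀ R > 0, (∀ r ≤ R, κ (ball z r) ≤ ENNReal.ofReal ε * ν (ball z r)) →
        |u x - f z * v x| ≤ b / a * ε * v x + b * κ.real univ / R ^ d * infDist x Dᶜ := by
    rintro x ⟨hxD, hxz⟩
    set δ := infDist x Dᶜ
    have hδ : 0 < δ := (hD_open.isClosed_compl.notMem_iff_infDist_pos ⟨z, hzD z hz⟩).1
      (fun h => h hxD)
    have hδw : ∀ w ∈ frontier D, δ ≤ dist x w := fun w hw => infDist_le_dist_of_mem (hzD w hw)
    have hlow : ∀ w ∈ frontier D, a * (δ / (δ + dist w z) ^ d) ≤ M x w := by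
      intro w hw
      refine le_trans ?_ (hM_lb x hxD w hw)
      have h1 : dist x w ≤ β * (δ + dist w z) := by
        have := dist_triangle_right x w z
        nlinarith [dist_nonneg (x := w) (y := z)]
      have h0 : 0 < dist x w := hδ.trans_le (hδw w hw)
      calc a * (δ / (δ + dist w z) ^ d) = c₁ * δ / (β * (δ + dist w z)) ^ d := by
            rw [mul_pow, div_mul_div_comm]
        _ ≤ c₁ * δ / dist x w ^ d := by gcongr
    have hup : ∀ w ∈ frontier D, M x w ≤ b * (δ / (δ + dist w z) ^ d) := by
      intro w hw
      refine (hM_ub x hxD w hw).trans ?_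
      have h0 : 0 < δ + dist w z := by positivity
      have h1 : (δ + dist w z) / (2 + β) ≤ dist x w := by
        rw [div_le_iff₀ (by positivity)]
        have := dist_triangle_left w z x
        nlinarith [hδw w hw]
      calc c₂ * δ / dist x w ^ d ≤ c₂ * δ / ((δ + dist w z) / (2 + β)) ^ d := by gcongr
        _ = b * (δ / (δ + dist w z) ^ d) := by
            rw [div_pow]
            simp only [b]
            field_simp
    have hpos : ∀ w ∈ frontier D, 0 < M x w := fun w hw =>
      lt_of_lt_of_le (by positivity) (hlow w hw)
    have hbound : ∀ w ∈ frontier D, ‖M x w‖ ≤ b * (δ / δ ^ d) := by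
      intro w hw
      rw [Real.norm_of_nonneg (hpos w hw).le]
      refine (hup w hw).trans ?_
      gcongr
      exact le_add_of_nonneg_right dist_nonneg
    have hMi : ∀ (m : Measure (EuclideanSpace ℝ (Fin d))) [IsFiniteMeasure m],
        (∀ᵐ w ∂m, w ∈ frontier D) → Integrable (M x) m := fun m _ hm =>
      .of_bound (hM_meas x).aestronglyMeasurable _ (hm.mono hbound)
    have hux : u x = ∫ w, M x w ∂μ := by
      rw [hu, Measure.restrict_eq_self_of_ae_mem hμ_ae]
    have hvx : v x = ∫ w, M x w ∂ν := by
      rw [hv, Measure.restrict_eq_self_of_ae_mem hν_ae]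
    refine ⟨?_, fun ε hε R hR h => ?_⟩
    · rw [hvx, integral_pos_iff_support_of_nonneg_ae
        (hν_ae.mono fun w hw => (hpos w hw).le) (hMi ν hν_ae)]
      obtain ⟨r₀, hr₀, hr⟩ := hν_pos
      exact (hr r₀ hr₀ le_rfl).trans_le (measure_mono fun w hw => (hpos w hw.1).ne')
    · rw [hux, hvx, hdecomp]
      refine (abs_integral_sub_const_mul_le hf_nonneg hf_int.aemeasurable (hM_meas x)
        (hMi ν hν_ae) (hMi μs hμs_ae) ?_ (hν_ae.mono fun w hw => (hpos w hw).le)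
        (hμs_ae.mono fun w hw => (hpos w hw).le)).trans ?_
      · exact hf_int.mul_bdd (hM_meas x).aestronglyMeasurable (hν_ae.mono hbound)
      · exact integral_kernel_le hR hε hδ ha hb.le hd0 h (hMi ν hν_ae) (hMi κ hκ_ae)
          (hν_ae.mono hlow) (hκ_ae.mono hup)
  rw [Metric.tendsto_nhds]
  intro η hη
  obtain ⟨ε, hε, hεη⟩ : ∃ ε > 0, b / a * ε = η / 2 :=
    ⟨η / 2 / (b / a), by positivity, mul_div_cancel₀ _ (by positivity)⟩
  obtain ⟨R, hR, hball⟩ :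
      ∃ R > 0, ∀ r ≤ R, κ (ball z r) ≤ ENNReal.ofReal ε * ν (ball z r) := by
    obtain ⟨r₀, hr₀, hr⟩ := hν_pos
    obtain ⟨r₁, hr₁, hr₁ε⟩ := mem_nhdsGT_iff_exists_Ioc_subset.1 (hLeb.eventually_lt_const hε)
    refine ⟨min r₀ r₁, lt_min hr₀ hr₁, fun r hrR => ?_⟩
    rcases le_or_gt r 0 with h0 | h0
    · simp [ball_eq_empty.2 h0]
    have hlt := hr₁ε ⟨h0, hrR.trans (min_le_right _ _)⟩
    have hνr := hr r h0 (hrR.trans (min_le_left _ _))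
    rw [mem_ofPred_eq, div_lt_iff₀ (ENNReal.toReal_pos hνr.ne' (measure_ne_top _ _))] at hlt
    rw [hκ_ball, ← hfrν r, ← ENNReal.ofReal_toReal (measure_ne_top ν (frontier D ∩ ball z r)),
      ← ENNReal.ofReal_mul hε.le]
    exact ENNReal.ofReal_le_ofReal hlt.le
  have hsmall : Tendsto (fun x => b * κ.real univ / R ^ d * (infDist x Dᶜ / v x))
      (𝓝[{x ∈ D | dist x z < β * infDist x Dᶜ}] z) (𝓝 0) := by
    simpa using hδv.const_mul (b * κ.real univ / R ^ d)
  filter_upwards [hsmall.eventually_lt_const (half_pos hη), self_mem_nhdsWithin] with x hx hxS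
  obtain ⟨hvx, hest⟩ := hStolz x hxS
  have hle := hest ε hε.le R hR hball
  rw [Real.dist_eq, div_sub' hvx.ne', abs_div, abs_of_pos hvx, div_lt_iff₀ hvx, mul_comm (v x)]
  rw [← mul_div_assoc, div_lt_iff₀ hvx] at hx
  rw [hεη] at hle
  linarith
end

section
/- Let μ and ν be finite nonnegative Borel measures on ∂D, and write μ = f·ν + μ_s, where f ∈ L¹(ν) is nonnegative and μ_s is a nonnegative measure singular with respect to ν (Lebesgue decomposition). Set u(x) = ∫_{∂D} M(x,w) dμ(w) and v(x) = ∫_{∂D} M(x,w) dν(w) for x ∈ D. Then for every β > 1 and for ν-almost every z ∈ ∂D, u(x)/v(x) → f(z) as x → z with x ∈ A_z^β. -/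
open MeasureTheory Metric Filter Topology Set
open scoped ENNReal

section RadialKernel

variable {X : Type*} [PseudoMetricSpace X] [MeasurableSpace X] [BorelSpace X]

/-- The superlevel sets of the radial kernel `w ↦ 1 / (δ + dist w z) ^ d`, except for the level
attained at `z` itself, are empty or closed balls of positive radius. -/
lemma superlevel_radial_kernel_eq {Y : Type*} [PseudoMetricSpace Y] {d : ℕ} (hd : d ≠ 0) (z : Y)
    {δ t : ℝ} (hδ : 0 < δ) (ht : 0 < t) (hne : t ≠ 1 / δ ^ d) :
    {w | t ≤ 1 / (δ + dist w z) ^ d} = ∅ ∨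
      ∃ s, 0 < s ∧ {w | t ≤ 1 / (δ + dist w z) ^ d} = closedBall z s := by
  rcases lt_or_gt_of_ne hne with h | h
  · right
    have hpow : ((1 / t) ^ ((d : ℝ)⁻¹)) ^ d = 1 / t :=
      Real.rpow_inv_natCast_pow (by positivity) hd
    set a : ℝ := (1 / t) ^ ((d : ℝ)⁻¹) with ha
    have ha0 : 0 ≤ a := by positivity
    have hδa : δ < a := by
      rw [← pow_lt_pow_iff_left₀ hδ.le ha0 hd, hpow]
      rw [lt_div_iff₀ (by positivity)] at h ⊢
      linarith
    refine ⟨a - δ, by linarith, ?_⟩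
    ext w
    have h1 : 0 < δ + dist w z := by positivity
    have h2 : δ + dist w z ≤ a ↔ (δ + dist w z) ^ d ≤ a ^ d :=
      (pow_le_pow_iff_left₀ h1.le ha0 hd).symm
    rw [hpow, le_div_iff₀ ht] at h2
    simp only [mem_ofPred_eq, mem_closedBall]
    rw [le_div_iff₀ (by positivity), mul_comm, ← h2]
    constructor <;> intro h <;> linarith
  · left
    rw [eq_empty_iff_forall_notMem]
    intro w hw
    have : 1 / (δ + dist w z) ^ d ≤ 1 / δ ^ d := by
      have := dist_nonneg (x := w) (y := z)
      gcongr
      linarith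
    exact absurd (hw.trans this) (not_le.2 h)

lemma measurable_radial_kernel (d : ℕ) (z : X) (δ : ℝ) :
    Measurable fun w : X => 1 / (δ + dist w z) ^ d := by
  have h : Measurable fun w : X => dist w z := (continuous_id.dist continuous_const).measurable
  exact measurable_const.div ((measurable_const.add h).pow_const d)

/-- A bound on the masses of small balls centered at `z` is inherited by the integrals of a radial
decreasing kernel over a small ball. -/
lemma setLIntegral_radial_kernel_le {d : ℕ} (hd : d ≠ 0) (κ ν : Measure X) (z : X) {δ η : ℝ}
    (hδ : 0 < δ) (hη : 0 < η) (ε : ℝ≥0∞)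
    (h : ∀ r, 0 < r → r ≤ η → κ (closedBall z r) ≤ ε * ν (closedBall z r)) :
    ∫⁻ w in closedBall z η, ENNReal.ofReal (1 / (δ + dist w z) ^ d) ∂κ ≤
      ε * ∫⁻ w, ENNReal.ofReal (1 / (δ + dist w z) ^ d) ∂ν := by
  have hnn : ∀ w : X, 0 ≤ 1 / (δ + dist w z) ^ d := fun w => by positivity
  have hm := measurable_radial_kernel d z δ
  rw [lintegral_eq_lintegral_meas_le _ (ae_of_all _ hnn) hm.aemeasurable,
    lintegral_eq_lintegral_meas_le _ (ae_of_all _ hnn) hm.aemeasurable]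
  have hanti : Antitone fun t : ℝ => ν {w : X | t ≤ 1 / (δ + dist w z) ^ d} :=
    fun s t hst => measure_mono fun w hw => le_trans hst hw
  rw [← lintegral_const_mul _ hanti.measurable]
  refine setLIntegral_mono_ae (hanti.measurable.const_mul ε).aemeasurable ?_
  have hae : ∀ᵐ t : ℝ, t ≠ 1 / δ ^ d := by simp [ae_iff]
  filter_upwards [hae] with t hne ht
  rw [Measure.restrict_apply (measurableSet_le measurable_const hm)]
  rcases superlevel_radial_kernel_eq hd z hδ ht hne with h0 | ⟨s, hs, h0⟩
  · rw [h0, empty_inter, measure_empty]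
    exact zero_le
  · have hcap : closedBall z s ∩ closedBall z η = closedBall z (min s η) := by
      ext w
      simp
    rw [h0, hcap]
    calc κ (closedBall z (min s η)) ≤ ε * ν (closedBall z (min s η)) :=
          h _ (lt_min hs hη) (min_le_right _ _)
      _ ≤ ε * ν (closedBall z s) := by
          gcongr
          exact min_le_left _ _

/-- If `κ` is negligible with respect to `ν` on small balls around `z`, and the `ν`-mass of these
balls is at least of order `r ^ (d - 1)`, then the integral of the kernel
`1 / (δ + dist w z) ^ d` with respect to `κ` is negligible as `δ → 0`. -/
lemma eventually_lintegral_radial_kernel_le {d : ℕ} (hd : d ≠ 0) (κ ν : Measure X)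
    (hκ : κ univ ≠ ∞) (z : X) {c : ℝ} (hc : 0 < c)
    (hκν : ∀ ε : ℝ, 0 < ε → ∀ᶠ r in 𝓝[>] (0 : ℝ),
      κ (closedBall z r) ≤ ENNReal.ofReal ε * ν (closedBall z r))
    (hν : ∀ᶠ r in 𝓝[>] (0 : ℝ), ENNReal.ofReal (c * r ^ (d - 1)) ≤ ν (closedBall z r))
    {ε : ℝ} (hε : 0 < ε) :
    ∀ᶠ δ in 𝓝[>] (0 : ℝ), ∫⁻ w, ENNReal.ofReal (1 / (δ + dist w z) ^ d) ∂κ ≤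
      ENNReal.ofReal ε * ∫⁻ w, ENNReal.ofReal (1 / (δ + dist w z) ^ d) ∂ν := by
  obtain ⟨η, hη, hη'⟩ := mem_nhdsGT_iff_exists_Ioc_subset.1 (hκν (ε / 2) (half_pos hε))
  have hη0 : 0 < η := hη
  set L : ℝ := (κ univ).toReal with hL
  have hL0 : 0 ≤ L := ENNReal.toReal_nonneg
  have hbound : 0 < ε / 2 * c * η ^ d / (2 ^ d * (L + 1)) := by positivity
  filter_upwards [hν, self_mem_nhdsWithin, Ioo_mem_nhdsGT hbound] with δ hνδ hδ hδ'
  have hδ0 : 0 < δ := hδ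
  set J := ∫⁻ w, ENNReal.ofReal (1 / (δ + dist w z) ^ d) ∂ν with hJ
  have hlow : ENNReal.ofReal (c / (2 ^ d * δ)) ≤ J := by
    calc ENNReal.ofReal (c / (2 ^ d * δ))
        = ENNReal.ofReal (1 / (δ + δ) ^ d) * ENNReal.ofReal (c * δ ^ (d - 1)) := by
          rw [← ENNReal.ofReal_mul (by positivity)]
          congr 1
          obtain ⟨k, rfl⟩ := Nat.exists_eq_succ_of_ne_zero hd
          rw [← two_mul, mul_pow]
          simp only [Nat.succ_eq_add_one, Nat.add_sub_cancel]
          field_simp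
          ring
      _ ≤ ENNReal.ofReal (1 / (δ + δ) ^ d) * ν (closedBall z δ) := by gcongr
      _ = ∫⁻ w in closedBall z δ, ENNReal.ofReal (1 / (δ + δ) ^ d) ∂ν := by simp
      _ ≤ ∫⁻ w in closedBall z δ, ENNReal.ofReal (1 / (δ + dist w z) ^ d) ∂ν := by
          refine setLIntegral_mono' measurableSet_closedBall fun w hw => ?_
          rw [mem_closedBall] at hw
          gcongr
      _ ≤ J := setLIntegral_le_lintegral _ _
  have htail : ∫⁻ w in (closedBall z η)ᶜ, ENNReal.ofReal (1 / (δ + dist w z) ^ d) ∂κ ≤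
      ENNReal.ofReal (ε / 2) * J := by
    calc ∫⁻ w in (closedBall z η)ᶜ, ENNReal.ofReal (1 / (δ + dist w z) ^ d) ∂κ
        ≤ ∫⁻ w in (closedBall z η)ᶜ, ENNReal.ofReal (1 / η ^ d) ∂κ := by
          refine setLIntegral_mono' measurableSet_closedBall.compl fun w hw => ?_
          rw [mem_compl_iff, mem_closedBall, not_le] at hw
          gcongr
          linarith
      _ ≤ ENNReal.ofReal (1 / η ^ d) * κ univ := by
          simp only [lintegral_const, Measure.restrict_apply, MeasurableSet.univ, univ_inter]
          gcongr
          exact subset_univ _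
      _ = ENNReal.ofReal (1 / η ^ d * L) := by
          rw [ENNReal.ofReal_mul (by positivity), hL, ENNReal.ofReal_toReal hκ]
      _ ≤ ENNReal.ofReal (ε / 2 * (c / (2 ^ d * δ))) := by
          apply ENNReal.ofReal_le_ofReal
          have h1 := hδ'.2
          rw [lt_div_iff₀ (by positivity)] at h1
          rw [← mul_div_assoc, le_div_iff₀ (by positivity), one_div, mul_assoc,
            inv_mul_le_iff₀ (by positivity)]
          have h2 : 0 < 2 ^ d * δ := by positivity
          nlinarith
      _ ≤ ENNReal.ofReal (ε / 2) * J := by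
          rw [ENNReal.ofReal_mul (by positivity)]
          gcongr
  have hnear := setLIntegral_radial_kernel_le hd κ ν z hδ0 hη0 (ENNReal.ofReal (ε / 2))
    fun r hr hrη => hη' ⟨hr, hrη⟩
  rw [← lintegral_add_compl _ (measurableSet_closedBall (x := z) (ε := η))]
  calc _ ≤ ENNReal.ofReal (ε / 2) * J + ENNReal.ofReal (ε / 2) * J := add_le_add hnear htail
    _ = ENNReal.ofReal ε * J := by
      rw [← add_mul, ← ENNReal.ofReal_add (by positivity) (by positivity), add_halves]

end RadialKernel

section Differentiation

variable {X : Type*} [MetricSpace X] [MeasurableSpace X] [BorelSpace X]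
  [SecondCountableTopology X] [HasBesicovitchCovering X]

/-- Almost every point is a Lebesgue point of `f` at which the singular measure `τ` has density
zero. -/
lemma ae_eventually_lebesgue_closedBall_le (ν τ : Measure X) [IsFiniteMeasure ν]
    [IsFiniteMeasure τ] (hτ : τ ⟂ₘ ν) {f : X → ℝ} (hf : Integrable f ν) :
    ∀ᵐ z ∂ν, ∀ ε : ℝ, 0 < ε → ∀ᶠ r in 𝓝[>] (0 : ℝ),
      (ν.withDensity (fun w => ‖f w - f z‖ₑ) + τ) (closedBall z r) ≤
        ENNReal.ofReal ε * ν (closedBall z r) := by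
  filter_upwards [(Besicovitch.vitaliFamily ν).ae_tendsto_lintegral_enorm_sub_div
    hf.locallyIntegrable, Besicovitch.ae_tendsto_rnDeriv τ ν, hτ.rnDeriv_ae_eq_zero]
    with z h1 h2 h3 ε hε
  have h1' := h1.comp (Besicovitch.tendsto_filterAt ν z)
  rw [h3] at h2
  have h4 := h1'.add h2
  simp only [Pi.zero_apply, add_zero] at h4
  have h5 := h4.eventually (gt_mem_nhds (ENNReal.ofReal_pos.2 hε))
  filter_upwards [h5] with r hr
  rw [Measure.add_apply, withDensity_apply _ measurableSet_closedBall,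
    ← ENNReal.div_le_iff_le_mul (Or.inr ENNReal.ofReal_ne_top) (Or.inl (measure_ne_top _ _)),
    ENNReal.add_div]
  exact hr.le

/-- Almost every ball mass of `ν` is locally bounded below by a multiple of that of `σ`. -/
lemma ae_exists_eventually_closedBall_le (ν σ : Measure X) [IsFiniteMeasure ν]
    [IsFiniteMeasure σ] :
    ∀ᵐ z ∂ν, ∃ K : ℝ, 0 < K ∧ ∀ᶠ r in 𝓝[>] (0 : ℝ),
      σ (closedBall z r) ≤ ENNReal.ofReal K * ν (closedBall z r) := by
  filter_upwards [Besicovitch.ae_tendsto_rnDeriv σ ν, σ.rnDeriv_lt_top ν] with z h1 h2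
  refine ⟨(σ.rnDeriv ν z).toReal + 1, by positivity, ?_⟩
  have h3 : σ.rnDeriv ν z < ENNReal.ofReal ((σ.rnDeriv ν z).toReal + 1) := by
    rw [ENNReal.lt_ofReal_iff_toReal_lt h2.ne]
    linarith
  filter_upwards [h1.eventually (gt_mem_nhds h3)] with r hr
  rw [← ENNReal.div_le_iff_le_mul (Or.inr ENNReal.ofReal_ne_top) (Or.inl (measure_ne_top _ _))]
  exact hr.le

end Differentiation

/-- If `μ = f·ν + τ`, then `∫ g dμ - a ∫ g dν` is controlled by the integral of `|g|` with respect to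
the measure `|f - a|·ν + τ`. -/
lemma enorm_integral_sub_mul_integral_le {X : Type*} [MeasurableSpace X] {μ ν τ : Measure X}
    {f g : X → ℝ} (hf_nonneg : ∀ w, 0 ≤ f w) (hf : Integrable f ν)
    (hμ : μ = ν.withDensity (fun w => ENNReal.ofReal (f w)) + τ)
    (hgμ : Integrable g μ) (hgν : Integrable g ν) (a : ℝ) :
    ‖∫ w, g w ∂μ - a * ∫ w, g w ∂ν‖ₑ ≤
      ∫⁻ w, ‖g w‖ₑ ∂(ν.withDensity (fun w => ‖f w - a‖ₑ) + τ) := by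
  have hfm : AEMeasurable (fun w => ENNReal.ofReal (f w)) ν := hf.aemeasurable.ennreal_ofReal
  have hlt : ∀ᵐ w ∂ν, ENNReal.ofReal (f w) < ∞ := ae_of_all _ fun w => ENNReal.ofReal_lt_top
  rw [hμ, integrable_add_measure] at hgμ
  have hfg := (integrable_withDensity_iff_integrable_smul₀' hfm hlt).1 hgμ.1
  rw [hμ, integral_add_measure hgμ.1 hgμ.2,
    integral_withDensity_eq_integral_toReal_smul₀ hfm hlt]
  simp only [ENNReal.toReal_ofReal (hf_nonneg _), smul_eq_mul] at hfg ⊢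
  have hrw : ∫ w, f w * g w ∂ν + ∫ w, g w ∂τ - a * ∫ w, g w ∂ν =
      ∫ w, (f w - a) * g w ∂ν + ∫ w, g w ∂τ := by
    simp only [sub_mul]
    rw [integral_sub hfg (hgν.const_mul a), integral_const_mul]
    ring
  rw [hrw, lintegral_add_measure, lintegral_withDensity_eq_lintegral_mul₀
    (hf.aemeasurable.sub_const a).enorm hgν.aemeasurable.enorm]
  refine (enorm_add_le _ _).trans (add_le_add ?_ (enorm_integral_le_lintegral_enorm _))
  refine (enorm_integral_le_lintegral_enorm _).trans (le_of_eq ?_)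
  simp [enorm_mul]

/-- In the Stolz set at `z`, the Martin kernel is comparable with the radial kernel
`δ / (δ + dist w z) ^ d`. -/
lemma martin_kernel_bounds {X : Type*} [PseudoMetricSpace X] {d : ℕ} {c₁ c₂ β δ m : ℝ}
    {x w z : X} (hc₁ : 0 ≤ c₁) (hc₂ : 0 ≤ c₂) (hβ : 1 < β) (hδ : 0 < δ)
    (hxz : dist x z < β * δ) (hxw : δ ≤ dist x w)
    (hlb : c₁ * δ / dist x w ^ d ≤ m) (hub : m ≤ c₂ * δ / dist x w ^ d) :
    c₁ / β ^ d * δ * (1 / (δ + dist w z) ^ d) ≤ m ∧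
      m ≤ c₂ * (2 + β) ^ d * δ * (1 / (δ + dist w z) ^ d) := by
  have hρ : 0 < dist x w := hδ.trans_le hxw
  have h0 : 0 ≤ dist w z := dist_nonneg
  have hup : dist x w ≤ β * (δ + dist w z) := by
    have := dist_triangle_right x w z
    nlinarith
  have hlow : δ + dist w z ≤ (2 + β) * dist x w := by
    have := dist_triangle_left w z x
    nlinarith
  constructor
  · refine le_trans ?_ hlb
    calc c₁ / β ^ d * δ * (1 / (δ + dist w z) ^ d) = c₁ * δ / (β * (δ + dist w z)) ^ d := by
          rw [mul_pow]
          field_simp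
      _ ≤ c₁ * δ / dist x w ^ d := by gcongr
  · refine hub.trans ?_
    calc c₂ * δ / dist x w ^ d = c₂ * (2 + β) ^ d * δ * (1 / ((2 + β) * dist x w) ^ d) := by
          rw [mul_pow]
          field_simp
      _ ≤ c₂ * (2 + β) ^ d * δ * (1 / (δ + dist w z) ^ d) := by gcongr

/-- Relative Fatou theorem, a.e. version.
Let `D ⊂ ℝ^d` (`d ≥ 2`) be a bounded open set, `M` a Borel kernel satisfying the Martin
kernel estimate, and `σ` a finite measure on `∂D` satisfying the lower Ahlfors condition.
Let `μ = f·ν + μ_s` be the Lebesgue decomposition of the finite measure `μ` on `∂D` with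
respect to the finite measure `ν` on `∂D`, and set `u(x) = ∫_{∂D} M(x,w) dμ(w)` and
`v(x) = ∫_{∂D} M(x,w) dν(w)`.  Then for every `β > 1` and `ν`-almost every `z ∈ ∂D`,
`u(x)/v(x) → f(z)` as `x → z` nontangentially (within the Stolz set `A_z^β`). -/
theorem stmt_1
    (d : ℕ) (hd : 2 ≤ d)
    (D : Set (EuclideanSpace ℝ (Fin d)))
    (hD_open : IsOpen D) (hD_bdd : Bornology.IsBounded D)
    (M : EuclideanSpace ℝ (Fin d) → EuclideanSpace ℝ (Fin d) → ℝ)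
    (hM_meas : ∀ x, Measurable fun w => M x w)
    (c₁ c₂ : ℝ) (hc₁ : 0 < c₁) (hc₁₂ : c₁ ≤ c₂)
    (hM_lb : ∀ x ∈ D, ∀ w ∈ frontier D,
      c₁ * infDist x Dᶜ / dist x w ^ d ≤ M x w)
    (hM_ub : ∀ x ∈ D, ∀ w ∈ frontier D,
      M x w ≤ c₂ * infDist x Dᶜ / dist x w ^ d)
    (σ : Measure (EuclideanSpace ℝ (Fin d))) [IsFiniteMeasure σ]
    (hσ_supp : σ (frontier D)ᶜ = 0)
    (C₁ R₁ : ℝ) (hC₁ : 0 < C₁) (hR₁ : 0 < R₁)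
    (hAhlfors : ∀ z ∈ frontier D, ∀ r : ℝ, 0 < r → r ≤ R₁ →
      ENNReal.ofReal (C₁ * r ^ (d - 1)) ≤ σ (frontier D ∩ ball z r))
    (μ ν : Measure (EuclideanSpace ℝ (Fin d)))
    [IsFiniteMeasure μ] [IsFiniteMeasure ν]
    (hμ_supp : μ (frontier D)ᶜ = 0) (hν_supp : ν (frontier D)ᶜ = 0)
    (f : EuclideanSpace ℝ (Fin d) → ℝ) (hf_nonneg : ∀ w, 0 ≤ f w)
    (hf_int : Integrable f ν)
    (μs : Measure (EuclideanSpace ℝ (Fin d))) [IsFiniteMeasure μs]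
    (hμs_supp : μs (frontier D)ᶜ = 0)
    (hμs_sing : μs ⟂ₘ ν)
    (hdecomp : μ = ν.withDensity (fun w => ENNReal.ofReal (f w)) + μs)
    (u v : EuclideanSpace ℝ (Fin d) → ℝ)
    (hu : ∀ x, u x = ∫ w in frontier D, M x w ∂μ)
    (hv : ∀ x, v x = ∫ w in frontier D, M x w ∂ν)
    (β : ℝ) (hβ : 1 < β) :
    ∀ᵐ z ∂ν, Tendsto (fun x => u x / v x)
      (𝓝[{x ∈ D | dist x z < β * infDist x Dᶜ}] z) (𝓝 (f z)) := by
  have hd0 : d ≠ 0 := by omega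
  have hc₂ : 0 < c₂ := hc₁.trans_le hc₁₂
  have hβ0 : 0 < β := by linarith
  have hμ_ae : ∀ᵐ w ∂μ, w ∈ frontier D := hμ_supp
  have hν_ae : ∀ᵐ w ∂ν, w ∈ frontier D := hν_supp
  have hμs_ae : ∀ᵐ w ∂μs, w ∈ frontier D := hμs_supp
  rw [Measure.restrict_eq_self_of_ae_mem hμ_ae] at hu
  rw [Measure.restrict_eq_self_of_ae_mem hν_ae] at hv
  have hfr : frontier D ⊆ Dᶜ := by
    rw [hD_open.frontier_eq]
    exact fun w hw => hw.2
  filter_upwards [hν_ae, ae_eventually_lebesgue_closedBall_le ν μs hμs_sing hf_int,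
    ae_exists_eventually_closedBall_le ν σ] with z hz hleb ⟨K, hK, hσν⟩
  set κ : Measure (EuclideanSpace ℝ (Fin d)) :=
    ν.withDensity (fun w => ‖f w - f z‖ₑ) + μs with hκ
  have hκ_ae : ∀ᵐ w ∂κ, w ∈ frontier D := by
    rw [hκ, ae_add_measure_iff]
    exact ⟨(withDensity_absolutelyContinuous _ _).ae_le hν_ae, hμs_ae⟩
  have hκ_fin : κ univ ≠ ∞ := by
    rw [hκ, Measure.add_apply, withDensity_apply _ MeasurableSet.univ, Measure.restrict_univ]
    exact ENNReal.add_ne_top.2 ⟨(hf_int.sub (integrable_const (f z))).2.ne, measure_ne_top _ _⟩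
  have hν_low : ∀ᶠ r in 𝓝[>] (0 : ℝ),
      ENNReal.ofReal (C₁ / K * r ^ (d - 1)) ≤ ν (closedBall z r) := by
    filter_upwards [hσν, Ioo_mem_nhdsGT hR₁] with r hr hrR
    have h1 := (hAhlfors z hz r hrR.1 hrR.2.le).trans
      ((measure_mono (inter_subset_right.trans ball_subset_closedBall)).trans hr)
    rw [mul_comm (ENNReal.ofReal K), ← ENNReal.div_le_iff_le_mul (Or.inl (ENNReal.ofReal_pos.2 hK).ne')
      (Or.inl ENNReal.ofReal_ne_top), ← ENNReal.ofReal_div_of_pos hK] at h1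
    rwa [div_mul_eq_mul_div]
  have hν0 : ν ≠ 0 := by
    rintro rfl
    obtain ⟨r, hr, hr0⟩ := (hν_low.and self_mem_nhdsWithin).exists
    have hr0 : 0 < r := hr0
    have : 0 < C₁ / K * r ^ (d - 1) := by positivity
    simp [this.not_ge] at hr
  have hDc : Dᶜ.Nonempty := ⟨z, hfr hz⟩
  have hδ_pos : ∀ x ∈ D, 0 < infDist x Dᶜ := fun x hx =>
    (hD_open.isClosed_compl.notMem_iff_infDist_pos hDc).1 (fun h => h hx)
  set S : Set (EuclideanSpace ℝ (Fin d)) := {x ∈ D | dist x z < β * infDist x Dᶜ} with hS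
  have hδ_lim : Tendsto (fun x => infDist x Dᶜ) (𝓝[S] z) (𝓝[>] 0) := by
    refine tendsto_nhdsWithin_iff.2 ⟨?_, ?_⟩
    · have h := (continuous_infDist_pt Dᶜ).tendsto z
      rw [infDist_zero_of_mem (hfr hz)] at h
      exact h.mono_left nhdsWithin_le_nhds
    · filter_upwards [self_mem_nhdsWithin] with x hx
      exact hδ_pos x hx.1
  set A : ℝ := c₂ * (2 + β) ^ d with hA
  set B : ℝ := c₁ / β ^ d with hB
  have hA0 : 0 < A := by positivity
  have hB0 : 0 < B := by positivity
  rw [Metric.tendsto_nhds]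
  intro e he
  have hε : 0 < e / 2 * B / A := by positivity
  have hker := hδ_lim.eventually (eventually_lintegral_radial_kernel_le hd0 κ ν hκ_fin z
    (div_pos hC₁ hK) hleb hν_low hε)
  filter_upwards [hker, self_mem_nhdsWithin] with x hx hxS
  set δ : ℝ := infDist x Dᶜ with hδ
  have hδ0 : 0 < δ := hδ_pos x hxS.1
  have hdist : ∀ w ∈ frontier D, δ ≤ dist x w := fun w hw => infDist_le_dist_of_mem (hfr hw)
  have hbd : ∀ w ∈ frontier D, B * δ * (1 / (δ + dist w z) ^ d) ≤ M x w ∧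
      M x w ≤ A * δ * (1 / (δ + dist w z) ^ d) := fun w hw =>
    martin_kernel_bounds hc₁.le hc₂.le hβ hδ0 hxS.2 (hdist w hw)
      (hM_lb x hxS.1 w hw) (hM_ub x hxS.1 w hw)
  have hM0 : ∀ w ∈ frontier D, 0 ≤ M x w := fun w hw =>
    le_trans (by positivity) (hbd w hw).1
  have hM_int : ∀ (m : Measure (EuclideanSpace ℝ (Fin d))) [IsFiniteMeasure m],
      (∀ᵐ w ∂m, w ∈ frontier D) → Integrable (M x) m := by
    intro m _ hm
    refine Integrable.of_bound (hM_meas x).aestronglyMeasurable (A * δ * (1 / δ ^ d)) ?_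
    filter_upwards [hm] with w hw
    rw [Real.norm_of_nonneg (hM0 w hw)]
    refine (hbd w hw).2.trans ?_
    gcongr
    linarith [dist_nonneg (x := w) (y := z)]
  set J := ∫⁻ w, ENNReal.ofReal (1 / (δ + dist w z) ^ d) ∂ν with hJ
  have hJ_le : ENNReal.ofReal (B * δ) * J ≤ ENNReal.ofReal (v x) := by
    rw [hv, ofReal_integral_eq_lintegral_ofReal (hM_int ν hν_ae) (hν_ae.mono hM0), hJ,
      ← lintegral_const_mul _ (measurable_radial_kernel d z δ).ennreal_ofReal]
    refine lintegral_mono_ae ?_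
    filter_upwards [hν_ae] with w hw
    rw [← ENNReal.ofReal_mul (by positivity)]
    exact ENNReal.ofReal_le_ofReal (hbd w hw).1
  have hJ_pos : 0 < J := by
    rw [hJ, lintegral_pos_iff_support (measurable_radial_kernel d z δ).ennreal_ofReal]
    have hsupp : Function.support
        (fun w => ENNReal.ofReal (1 / (δ + dist w z) ^ d)) = univ := by
      refine eq_univ_of_forall fun w => ?_
      have : 0 < 1 / (δ + dist w z) ^ d := by positivity
      exact (ENNReal.ofReal_pos.2 this).ne'
    rw [hsupp]
    exact Measure.measure_univ_pos.2 hν0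
  have hv_pos : 0 < v x := ENNReal.ofReal_pos.1 <| lt_of_lt_of_le
    (ENNReal.mul_pos (ENNReal.ofReal_pos.2 (mul_pos hB0 hδ0)).ne' hJ_pos.ne') hJ_le
  have hdiff : ‖u x - f z * v x‖ₑ ≤ ENNReal.ofReal (e / 2 * v x) := by
    calc ‖u x - f z * v x‖ₑ ≤ ∫⁻ w, ‖M x w‖ₑ ∂κ := by
          rw [hu, hv]
          exact enorm_integral_sub_mul_integral_le hf_nonneg hf_int hdecomp (hM_int μ hμ_ae)
            (hM_int ν hν_ae) (f z)
      _ ≤ ∫⁻ w, ENNReal.ofReal (A * δ) * ENNReal.ofReal (1 / (δ + dist w z) ^ d) ∂κ := by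
          refine lintegral_mono_ae ?_
          filter_upwards [hκ_ae] with w hw
          rw [Real.enorm_eq_ofReal (hM0 w hw), ← ENNReal.ofReal_mul (by positivity)]
          exact ENNReal.ofReal_le_ofReal (hbd w hw).2
      _ = ENNReal.ofReal (A * δ) * ∫⁻ w, ENNReal.ofReal (1 / (δ + dist w z) ^ d) ∂κ :=
          lintegral_const_mul _ (measurable_radial_kernel d z δ).ennreal_ofReal
      _ ≤ ENNReal.ofReal (A * δ) * (ENNReal.ofReal (e / 2 * B / A) * J) := by gcongr
      _ = ENNReal.ofReal (e / 2) * (ENNReal.ofReal (B * δ) * J) := by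
          rw [← mul_assoc, ← mul_assoc, ← ENNReal.ofReal_mul (by positivity),
            ← ENNReal.ofReal_mul (by positivity)]
          congr 2
          field_simp
      _ ≤ ENNReal.ofReal (e / 2) * ENNReal.ofReal (v x) := by gcongr
      _ = ENNReal.ofReal (e / 2 * v x) := (ENNReal.ofReal_mul (by positivity)).symm
  rw [Real.enorm_eq_ofReal_abs, ENNReal.ofReal_le_ofReal_iff (by positivity)] at hdiff
  rw [Real.dist_eq, div_sub' hv_pos.ne', abs_div, abs_of_pos hv_pos, div_lt_iff₀ hv_pos,
    mul_comm (v x)]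
  refine hdiff.trans_lt ?_
  gcongr
  linarith
end

section
/- Let ν be a finite nonnegative Borel measure on ∂D and set v(x) = ∫_{∂D} M(x,w) dν(w) for x ∈ D. Then for ν-almost every z ∈ ∂D and every β > 1: liminf of v(x) as x → z with x ∈ A_z^β is strictly positive; in particular, for ν-almost every z ∈ ∂D and every β > 1, δ_D(x)/v(x) → 0 as x → z with x ∈ A_z^β. -/
open MeasureTheory Metric Filter Topology Set

/-- If `σ` dominates `C * r ^ n` on small balls centred in `S`, then at `ν`-almost every point of
`S` so does `ν`, up to a constant depending on the point. -/
theorem ae_exists_mul_pow_le_measureReal_closedBall {E : Type*} [NormedAddCommGroup E]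
    [NormedSpace ℝ E] [FiniteDimensional ℝ E] [MeasurableSpace E] [BorelSpace E]
    (σ ν : Measure E) [IsFiniteMeasure σ] [IsFiniteMeasure ν] (S : Set E) (n : ℕ)
    (C R : ℝ) (hC : 0 < C) (hR : 0 < R)
    (hσ : ∀ z ∈ S, ∀ r : ℝ, 0 < r → r ≤ R →
      ENNReal.ofReal (C * r ^ n) ≤ σ (S ∩ ball z r)) :
    ∀ᵐ z ∂ν, z ∈ S → ∃ c : ℝ, 0 < c ∧
      ∀ᶠ r in 𝓝[>] (0 : ℝ), c * r ^ n ≤ ν.real (closedBall z r) := by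
  filter_upwards [Besicovitch.ae_tendsto_rnDeriv σ ν, Measure.rnDeriv_lt_top σ ν] with z hz hfin hzS
  obtain ⟨K, hK, -⟩ := ENNReal.lt_iff_exists_nnreal_btwn.1 hfin
  have hK0 : (0 : ℝ) < K := by
    have : (0 : ENNReal) < K := bot_le.trans_lt hK
    exact_mod_cast this
  refine ⟨C / K, div_pos hC hK0, ?_⟩
  filter_upwards [hz.eventually_lt_const hK, Ioc_mem_nhdsGT hR] with r hlt hr
  have hle : σ (closedBall z r) ≤ K * ν (closedBall z r) :=
    (ENNReal.div_le_iff_le_mul (Or.inr ENNReal.coe_ne_top)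
      (Or.inl (measure_ne_top _ _))).1 hlt.le
  have hlow := (hσ z hzS r hr.1 hr.2).trans
    ((measure_mono (inter_subset_right.trans ball_subset_closedBall)).trans hle)
  have hreal : C * r ^ n ≤ K * ν.real (closedBall z r) := by
    have := (ENNReal.ofReal_le_iff_le_toReal
      (ENNReal.mul_ne_top ENNReal.coe_ne_top (measure_ne_top _ _))).1 hlow
    simpa [Measure.real] using this
  rw [div_mul_eq_mul_div, div_le_iff₀ hK0]
  linarith

/-- Positivity of Martin integrals along nontangential approach.
Let `D ⊂ ℝ^d` (`d ≥ 2`) be a bounded open set, `M` a Borel kernel satisfying the Martin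
kernel estimate, and `σ` a finite measure on `∂D` satisfying the lower Ahlfors condition.
Let `ν` be a finite measure on `∂D` and `v(x) = ∫_{∂D} M(x,w) dν(w)`.  Then for
`ν`-almost every `z ∈ ∂D` and every `β > 1`:  the `liminf` of `v` along the
nontangential approach to `z` is strictly positive (i.e. `v` is eventually bounded below
by some `ε > 0` on the Stolz set near `z`); in particular `δ_D(x)/v(x) → 0` as
`x → z` within `A_z^β`. -/
theorem stmt_3
    (d : ℕ) (hd : 2 ≤ d)
    (D : Set (EuclideanSpace ℝ (Fin d)))
    (hD_open : IsOpen D) (hD_bdd : Bornology.IsBounded D)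
    (M : EuclideanSpace ℝ (Fin d) → EuclideanSpace ℝ (Fin d) → ℝ)
    (hM_meas : ∀ x, Measurable fun w => M x w)
    (c₁ c₂ : ℝ) (hc₁ : 0 < c₁) (hc₁₂ : c₁ ≤ c₂)
    (hM_lb : ∀ x ∈ D, ∀ w ∈ frontier D,
      c₁ * infDist x Dᶜ / dist x w ^ d ≤ M x w)
    (hM_ub : ∀ x ∈ D, ∀ w ∈ frontier D,
      M x w ≤ c₂ * infDist x Dᶜ / dist x w ^ d)
    (σ : Measure (EuclideanSpace ℝ (Fin d))) [IsFiniteMeasure σ]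
    (hσ_supp : σ (frontier D)ᶜ = 0)
    (C₁ R₁ : ℝ) (hC₁ : 0 < C₁) (hR₁ : 0 < R₁)
    (hAhlfors : ∀ z ∈ frontier D, ∀ r : ℝ, 0 < r → r ≤ R₁ →
      ENNReal.ofReal (C₁ * r ^ (d - 1)) ≤ σ (frontier D ∩ ball z r))
    (ν : Measure (EuclideanSpace ℝ (Fin d))) [IsFiniteMeasure ν]
    (hν_supp : ν (frontier D)ᶜ = 0)
    (v : EuclideanSpace ℝ (Fin d) → ℝ)
    (hv : ∀ x, v x = ∫ w in frontier D, M x w ∂ν) :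
    ∀ᵐ z ∂ν, ∀ β : ℝ, 1 < β →
      (∃ ε : ℝ, 0 < ε ∧
        ∀ᶠ x in 𝓝[{x ∈ D | dist x z < β * infDist x Dᶜ}] z, ε ≤ v x) ∧
      Tendsto (fun x => infDist x Dᶜ / v x)
        (𝓝[{x ∈ D | dist x z < β * infDist x Dᶜ}] z) (𝓝 0) := by
  have hν_mem : ∀ᵐ z ∂ν, z ∈ frontier D := hν_supp
  filter_upwards [hν_mem, ae_exists_mul_pow_le_measureReal_closedBall σ ν (frontier D) (d - 1)
    C₁ R₁ hC₁ hR₁ hAhlfors] with z hz hgrowth β hβ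
  obtain ⟨c, hc, hball⟩ := hgrowth hz
  have hfr : ∀ w ∈ frontier D, w ∈ Dᶜ := fun w hw => (hD_open.frontier_eq ▸ hw).2
  have hβ0 : 0 < β := by linarith
  have hlower : ∃ ε : ℝ, 0 < ε ∧
      ∀ᶠ x in 𝓝[{x ∈ D | dist x z < β * infDist x Dᶜ}] z, ε ≤ v x := by
    refine ⟨c₁ * c / (2 ^ d * β), by positivity, ?_⟩
    have hdist : Tendsto (fun x => dist x z) (𝓝[{x ∈ D | dist x z < β * infDist x Dᶜ}] z)
        (𝓝[>] 0) := by
      refine tendsto_nhdsWithin_iff.2 ⟨?_, ?_⟩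
      · have h : Continuous fun x : EuclideanSpace ℝ (Fin d) => dist x z := by fun_prop
        simpa using (h.tendsto z).mono_left nhdsWithin_le_nhds
      · filter_upwards [self_mem_nhdsWithin] with x hx
        exact dist_pos.2 fun h => hfr z hz (h ▸ hx.1)
    filter_upwards [hdist.eventually hball, hdist.eventually self_mem_nhdsWithin,
      self_mem_nhdsWithin] with x hνx hr hx
    obtain ⟨hxD, hxβ⟩ := hx
    set r := dist x z
    set δ := infDist x Dᶜ
    have hr0 : 0 < r := hr
    have hδ : 0 < δ := by
      by_contra! h
      nlinarith
    have hδw : ∀ w ∈ frontier D, δ ≤ dist x w := fun w hw => infDist_le_dist_of_mem (hfr w hw)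
    have hmeas : MeasurableSet (frontier D) := isClosed_frontier.measurableSet
    have hM0 : ∀ w ∈ frontier D, 0 ≤ M x w := fun w hw =>
      le_trans (by positivity) (hM_lb x hxD w hw)
    have hint : IntegrableOn (M x) (frontier D) ν := by
      refine Measure.integrableOn_of_bounded (M := c₂ * δ / δ ^ d) (measure_ne_top _ _)
        (hM_meas x).aestronglyMeasurable ?_
      filter_upwards [ae_restrict_mem hmeas] with w hw
      rw [Real.norm_of_nonneg (hM0 w hw)]
      refine (hM_ub x hxD w hw).trans ?_
      have := hδw w hw
      have hc₂ : 0 < c₂ := hc₁.trans_le hc₁₂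
      gcongr
    have hset : MeasurableSet (frontier D ∩ closedBall z r) :=
      hmeas.inter isClosed_closedBall.measurableSet
    have hνeq : ν.real (frontier D ∩ closedBall z r) = ν.real (closedBall z r) := by
      refine measureReal_congr ?_
      filter_upwards [hν_mem] with w hw
      exact propext ⟨fun h => h.2, fun h => ⟨hw, h⟩⟩
    have hconst : ∀ w ∈ frontier D ∩ closedBall z r, c₁ * δ / (2 * r) ^ d ≤ M x w := by
      intro w hw
      refine le_trans ?_ (hM_lb x hxD w hw.1)
      have h1 : dist x w ≤ 2 * r := by
        have := dist_triangle_right x w z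
        have := mem_closedBall.1 hw.2
        linarith
      have h2 : 0 < dist x w := hδ.trans_le (hδw w hw.1)
      gcongr
    calc c₁ * c / (2 ^ d * β) ≤ c₁ * δ / (2 * r) ^ d * (c * r ^ (d - 1)) := by
          obtain ⟨n, rfl⟩ : ∃ n, d = n + 1 := ⟨d - 1, by omega⟩
          have : c₁ * δ / (2 * r) ^ (n + 1) * (c * r ^ (n + 1 - 1))
              = c₁ * c * δ / (2 ^ (n + 1) * r) := by
            rw [Nat.add_sub_cancel, mul_pow, pow_succ r]
            field_simp
          rw [this, div_le_div_iff₀ (by positivity) (by positivity)]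
          have : 0 < c₁ * c * 2 ^ (n + 1) := by positivity
          nlinarith
      _ ≤ c₁ * δ / (2 * r) ^ d * ν.real (frontier D ∩ closedBall z r) := by
          rw [hνeq]
          gcongr
      _ ≤ ∫ w in frontier D ∩ closedBall z r, M x w ∂ν :=
          setIntegral_ge_of_const_le_real hset (measure_ne_top _ _) hconst
            (hint.mono_set inter_subset_left)
      _ ≤ ∫ w in frontier D, M x w ∂ν := by
          refine setIntegral_mono_set hint ?_ (Eventually.of_forall inter_subset_left)
          filter_upwards [ae_restrict_mem hmeas] with w hw using hM0 w hw
      _ = v x := (hv x).symm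
  refine ⟨hlower, ?_⟩
  obtain ⟨ε, hε, hev⟩ := hlower
  have hlim : Tendsto (fun x => infDist x Dᶜ / ε)
      (𝓝[{x ∈ D | dist x z < β * infDist x Dᶜ}] z) (𝓝 0) := by
    have h := ((continuous_infDist_pt Dᶜ).div_const ε).tendsto z
    rw [infDist_zero_of_mem (hfr z hz), zero_div] at h
    exact h.mono_left nhdsWithin_le_nhds
  refine tendsto_of_tendsto_of_tendsto_of_le_of_le' tendsto_const_nhds hlim ?_ ?_
  · filter_upwards [hev] with x hx
    exact div_nonneg infDist_nonneg (hε.le.trans hx)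
  · filter_upwards [hev] with x hx
    exact div_le_div_of_nonneg_left infDist_nonneg hε hx
end

section
/- Let s : ∂D → ℝ be a Borel function with 0 < a ≤ s(w) ≤ b for all w ∈ ∂D, and set F(x) = ∫_{∂D} M(x,w) s(w) dσ(w) for x ∈ D. Assume that F(x) → 1 as D ∋ x → z, for every z ∈ ∂D. Then for every finite nonnegative Borel measure μ on ∂D and every β > 1, the function u(x) = ∫_{∂D} M(x,w) dμ(w) has a nontangential limit at σ-almost every z ∈ ∂D; that is, for σ-a.e. z ∈ ∂D, the limit of u(x) as x → z with x ∈ A_z^β exists and is finite. -/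
open MeasureTheory Metric Filter Topology Set

open scoped ENNReal

lemma ofReal_div_max_pow_le_tsum (n : ℕ) {δ ρ : ℝ} (hδ : 0 < δ) :
    ENNReal.ofReal (δ / max δ ρ ^ (n + 1)) ≤
      ∑' k : ℕ, (if ρ ≤ 2 ^ k * δ then
        ENNReal.ofReal (2 ^ (n + 1) * (1 / 2) ^ k / (2 ^ k * δ) ^ n) else 0) := by
  have hex : ∃ k : ℕ, ρ ≤ 2 ^ k * δ := by
    obtain ⟨k, hk⟩ := pow_unbounded_of_one_lt (ρ / δ) (one_lt_two : (1 : ℝ) < 2)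
    exact ⟨k, by rw [div_lt_iff₀ hδ] at hk; exact hk.le⟩
  classical
  refine le_trans ?_ (ENNReal.le_tsum (Nat.find hex))
  rw [if_pos (Nat.find_spec hex)]
  apply ENNReal.ofReal_le_ofReal
  have hhalf : 2 ^ Nat.find hex * δ / 2 ≤ max δ ρ := by
    rcases Nat.eq_zero_or_pos (Nat.find hex) with h0 | h0
    · rw [h0]
      refine le_trans ?_ (le_max_left _ _)
      linarith
    · have h := Nat.find_min hex (Nat.sub_lt h0 one_pos)
      obtain ⟨j, hj⟩ := Nat.exists_eq_succ_of_ne_zero h0.ne'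
      rw [hj] at h ⊢
      simp only [Nat.succ_eq_add_one, Nat.add_sub_cancel, not_le] at h ⊢
      refine le_trans ?_ (le_max_right _ _)
      rw [pow_succ]
      linarith
  generalize Nat.find hex = k at hhalf
  have hk : (0 : ℝ) < 2 ^ k := by positivity
  calc δ / max δ ρ ^ (n + 1) ≤ δ / (2 ^ k * δ / 2) ^ (n + 1) := by gcongr
    _ = 2 ^ (n + 1) * (1 / 2) ^ k / (2 ^ k * δ) ^ n := by
      simp only [div_pow, one_pow]
      field_simp
      ring

/-- A finite measure whose closed balls around `z` have mass `o(r ^ n)` has vanishing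
Poisson-type averages at `z`. -/
lemma tendsto_lintegral_div_max_pow {E : Type*} [PseudoMetricSpace E] [MeasurableSpace E]
    [OpensMeasurableSpace E] (n : ℕ) (τ : Measure E) [IsFiniteMeasure τ] (z : E)
    (hτ : Tendsto (fun r : ℝ => τ (closedBall z r) / ENNReal.ofReal (r ^ n)) (𝓝[>] 0) (𝓝 0)) :
    Tendsto (fun δ : ℝ => ∫⁻ w, ENNReal.ofReal (δ / max δ (dist w z) ^ (n + 1)) ∂τ)
      (𝓝[>] 0) (𝓝 0) := by
  set m : ℝ → ℝ≥0∞ := fun r => τ (closedBall z r) / ENNReal.ofReal (r ^ n) with hm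
  obtain ⟨K, hK, hmK⟩ : ∃ K : ℝ≥0∞, K ≠ ∞ ∧ ∀ r : ℝ, 0 < r → m r ≤ K := by
    have h1 : ∀ᶠ r in 𝓝[>] (0 : ℝ), m r < 1 := hτ.eventually_lt_const one_pos
    obtain ⟨r₀, hr₀, h⟩ := mem_nhdsGT_iff_exists_Ioo_subset.1 h1
    have hr₀' : (0 : ℝ) < r₀ := hr₀
    refine ⟨1 + τ univ / ENNReal.ofReal (r₀ ^ n), ?_, fun r hr => ?_⟩
    · refine ENNReal.add_ne_top.2 ⟨ENNReal.one_ne_top, ENNReal.div_ne_top (measure_ne_top _ _) ?_⟩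
      simp only [ne_eq, ENNReal.ofReal_eq_zero, not_le]
      positivity
    · rcases lt_or_ge r r₀ with hlt | hge
      · exact (le_of_lt (h ⟨hr, hlt⟩)).trans le_self_add
      · refine le_trans ?_ le_add_self
        simp only [hm]
        gcongr
        exact subset_univ _
  have hbound : ∀ δ : ℝ, 0 < δ →
      ∫⁻ w, ENNReal.ofReal (δ / max δ (dist w z) ^ (n + 1)) ∂τ ≤
        ∑' k : ℕ, ENNReal.ofReal (2 ^ (n + 1) * (1 / 2) ^ k) * m (2 ^ k * δ) := by
    intro δ hδ
    calc _ ≤ ∫⁻ w, ∑' k : ℕ, (closedBall z (2 ^ k * δ)).indicator (fun _ =>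
          ENNReal.ofReal (2 ^ (n + 1) * (1 / 2) ^ k / (2 ^ k * δ) ^ n)) w ∂τ := by
          refine lintegral_mono fun w => (ofReal_div_max_pow_le_tsum n hδ).trans (le_of_eq ?_)
          simp only [indicator, mem_closedBall]
      _ = _ := by
          rw [lintegral_tsum fun k =>
            (measurable_const.indicator measurableSet_closedBall).aemeasurable]
          refine tsum_congr fun k => ?_
          rw [lintegral_indicator_const measurableSet_closedBall,
            ENNReal.ofReal_div_of_pos (by positivity)]
          simp only [hm, div_eq_mul_inv]
          ring
  have hsum : Tendsto (fun δ : ℝ =>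
      ∑' k : ℕ, ENNReal.ofReal (2 ^ (n + 1) * (1 / 2) ^ k) * m (2 ^ k * δ)) (𝓝[>] 0) (𝓝 0) := by
    simp_rw [← lintegral_count]
    have key := tendsto_lintegral_filter_of_dominated_convergence (μ := Measure.count)
      (l := 𝓝[>] (0 : ℝ))
      (F := fun (δ : ℝ) (k : ℕ) => ENNReal.ofReal (2 ^ (n + 1) * (1 / 2) ^ k) * m (2 ^ k * δ))
      (f := fun _ => 0) (fun k : ℕ => ENNReal.ofReal (2 ^ (n + 1) * (1 / 2) ^ k) * K)
      (Eventually.of_forall fun δ => measurable_from_nat) ?_ ?_ ?_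
    · simpa using key
    · filter_upwards [self_mem_nhdsWithin] with δ hδ
      refine Eventually.of_forall fun k => ?_
      have hδ' : (0 : ℝ) < δ := hδ
      exact mul_le_mul_right (hmK _ (by positivity)) _
    · rw [lintegral_count, ENNReal.tsum_mul_right]
      refine ENNReal.mul_ne_top ?_ hK
      rw [← ENNReal.ofReal_tsum_of_nonneg (fun k => by positivity)
        (summable_geometric_two.mul_left _)]
      exact ENNReal.ofReal_ne_top
    · refine Eventually.of_forall fun k => ?_
      rw [← mul_zero (ENNReal.ofReal (2 ^ (n + 1) * (1 / 2) ^ k))]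
      refine ENNReal.Tendsto.const_mul (hτ.comp ?_) (Or.inr ENNReal.ofReal_ne_top)
      refine tendsto_nhdsWithin_iff.2 ⟨?_, ?_⟩
      · refine Tendsto.mono_left ?_ nhdsWithin_le_nhds
        have : Continuous fun δ : ℝ => 2 ^ k * δ := by fun_prop
        simpa using this.tendsto 0
      · filter_upwards [self_mem_nhdsWithin] with δ hδ
        have hδ' : (0 : ℝ) < δ := hδ
        exact mul_pos (by positivity) hδ'
  refine tendsto_of_tendsto_of_tendsto_of_le_of_le' tendsto_const_nhds hsum
    (Eventually.of_forall fun _ => zero_le) ?_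
  filter_upwards [self_mem_nhdsWithin] with δ hδ using hbound δ hδ

/-- A measure dominating the total variation of `μ - c • ν`: the singular part of `μ` plus
`|dμ/dν - c| ν`. -/
noncomputable def deviationMeasure {E : Type*} [MeasurableSpace E] (μ ν : Measure E) (c : ℝ) :
    Measure E :=
  μ.singularPart ν + ν.withDensity fun w => ‖(μ.rnDeriv ν w).toReal - c‖ₑ

instance isFiniteMeasure_deviationMeasure {E : Type*} [MeasurableSpace E] (μ ν : Measure E)
    [IsFiniteMeasure μ] [IsFiniteMeasure ν] (c : ℝ) :
    IsFiniteMeasure (deviationMeasure μ ν c) := by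
  have h : Integrable (fun w => (μ.rnDeriv ν w).toReal - c) ν :=
    Measure.integrable_toReal_rnDeriv.sub (integrable_const c)
  have := isFiniteMeasure_withDensity h.2.ne
  unfold deviationMeasure
  infer_instance

lemma enorm_integral_sub_const_mul_le {E : Type*} [MeasurableSpace E] (μ ν : Measure E)
    [IsFiniteMeasure μ] [IsFiniteMeasure ν] (c : ℝ) {K : E → ℝ} (hK : Measurable K)
    (hμ : Integrable K μ) (hν : Integrable K ν) :
    ‖∫ w, K w ∂μ - c * ∫ w, K w ∂ν‖ₑ ≤ ∫⁻ w, ‖K w‖ₑ ∂deviationMeasure μ ν c := by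
  have hdec := Measure.haveLebesgueDecomposition_add μ ν
  have hs : Integrable K (μ.singularPart ν) := hμ.mono_measure (Measure.singularPart_le μ ν)
  have hr : Integrable K (ν.withDensity (μ.rnDeriv ν)) :=
    hμ.mono_measure (Measure.withDensity_rnDeriv_le μ ν)
  have hr' : Integrable (fun w => (μ.rnDeriv ν w).toReal * K w) ν :=
    (integrable_withDensity_iff_integrable_smul' (Measure.measurable_rnDeriv μ ν)
      (Measure.rnDeriv_lt_top μ ν)).1 hr
  have heq : ∫ w, K w ∂μ - c * ∫ w, K w ∂ν =
      ∫ w, K w ∂(μ.singularPart ν) + ∫ w, ((μ.rnDeriv ν w).toReal - c) * K w ∂ν := by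
    simp_rw [sub_mul]
    rw [integral_sub hr' (hν.const_mul c), integral_const_mul]
    conv_lhs => rw [hdec]
    rw [integral_add_measure hs hr, integral_withDensity_eq_integral_toReal_smul
      (Measure.measurable_rnDeriv μ ν) (Measure.rnDeriv_lt_top μ ν)]
    simp only [smul_eq_mul]
    ring
  have hmeas : Measurable fun w => ‖(μ.rnDeriv ν w).toReal - c‖ₑ := by
    have := Measure.measurable_rnDeriv μ ν
    fun_prop
  rw [heq, deviationMeasure, lintegral_add_measure,
    lintegral_withDensity_eq_lintegral_mul _ hmeas hK.enorm]
  refine (enorm_add_le _ _).trans (add_le_add (enorm_integral_le_lintegral_enorm _) ?_)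
  refine (enorm_integral_le_lintegral_enorm _).trans (le_of_eq ?_)
  simp only [enorm_mul, Pi.mul_apply]

lemma ae_tendsto_deviationMeasure_div {E : Type*} [NormedAddCommGroup E] [NormedSpace ℝ E]
    [FiniteDimensional ℝ E] [MeasurableSpace E] [BorelSpace E] (μ ν : Measure E)
    [IsFiniteMeasure μ] [IsFiniteMeasure ν] :
    ∀ᵐ z ∂ν, Tendsto (fun r => deviationMeasure μ ν (μ.rnDeriv ν z).toReal (closedBall z r) /
      ν (closedBall z r)) (𝓝[>] 0) (𝓝 0) := by
  have : ProperSpace E := FiniteDimensional.proper_real E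
  have h1 := Besicovitch.ae_tendsto_rnDeriv (μ.singularPart ν) ν
  have h2 := (Besicovitch.vitaliFamily ν).ae_tendsto_lintegral_enorm_sub_div
    (Measure.integrable_toReal_rnDeriv (μ := μ) (ν := ν)).locallyIntegrable
  have h0 := Measure.rnDeriv_singularPart μ ν
  filter_upwards [h1, h2, h0] with z h1 h2 h0
  rw [h0] at h1
  have h3 := h1.add (h2.comp (Besicovitch.tendsto_filterAt ν z))
  simp only [Pi.zero_apply, add_zero] at h3
  refine h3.congr fun r => ?_
  simp only [Function.comp_apply, deviationMeasure, Measure.add_apply,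
    withDensity_apply _ measurableSet_closedBall, ENNReal.add_div]

/-- Almost everywhere on a set where `ν` is upper `n`-regular, the deviation of `μ` from its
density times `ν` has small balls of mass `o(r ^ n)`. -/
lemma ae_tendsto_deviationMeasure_div_pow {E : Type*} [NormedAddCommGroup E] [NormedSpace ℝ E]
    [FiniteDimensional ℝ E] [MeasurableSpace E] [BorelSpace E] (μ ν : Measure E)
    [IsFiniteMeasure μ] [IsFiniteMeasure ν] (n : ℕ) {C : ℝ≥0∞} (hC : C ≠ ∞)
    (hν : ∀ᵐ z ∂ν, ∀ᶠ r in 𝓝[>] (0 : ℝ), ν (closedBall z r) ≤ C * ENNReal.ofReal (r ^ n)) :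
    ∀ᵐ z ∂ν, Tendsto (fun r => deviationMeasure μ ν (μ.rnDeriv ν z).toReal (closedBall z r) /
      ENNReal.ofReal (r ^ n)) (𝓝[>] 0) (𝓝 0) := by
  filter_upwards [ae_tendsto_deviationMeasure_div μ ν, hν] with z hz hν
  have hC0 := ENNReal.Tendsto.const_mul hz (Or.inr hC)
  rw [mul_zero] at hC0
  refine tendsto_of_tendsto_of_tendsto_of_le_of_le' tendsto_const_nhds hC0
    (Eventually.of_forall fun _ => zero_le) ?_
  filter_upwards [hν, self_mem_nhdsWithin, hz.eventually_lt_const one_pos] with r hr hr0 hlt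
  have hr0' : (0 : ℝ) < r := hr0
  set t := deviationMeasure μ ν (μ.rnDeriv ν z).toReal (closedBall z r)
  have ht : t ≤ t / ν (closedBall z r) * ν (closedBall z r) := by
    rcases eq_or_ne (ν (closedBall z r)) 0 with h | h
    · rcases eq_or_ne t 0 with ht | ht
      · simp [ht]
      · rw [h, ENNReal.div_zero ht] at hlt
        exact absurd hlt (by simp)
    · rw [ENNReal.div_mul_cancel h (measure_ne_top _ _)]
  refine ENNReal.div_le_of_le_mul (ht.trans ?_)
  calc t / ν (closedBall z r) * ν (closedBall z r)
      ≤ t / ν (closedBall z r) * (C * ENNReal.ofReal (r ^ n)) := by gcongr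
    _ = _ := by ring

/-- Fatou theorem for Martin integrals.
Let `D ⊂ ℝ^d` (`d ≥ 2`) be a bounded open set, `M` a Borel kernel satisfying the Martin
kernel estimate, and `σ` a finite measure on `∂D` satisfying the two-sided Ahlfors
regularity condition.  Let `s : ∂D → ℝ` be Borel with `0 < a ≤ s ≤ b` and set
`F(x) = ∫_{∂D} M(x,w) s(w) dσ(w)`, and assume `F(x) → 1` as `D ∋ x → z` for every
`z ∈ ∂D`.  Then for every finite measure `μ` on `∂D` and every `β > 1`, the function
`u(x) = ∫_{∂D} M(x,w) dμ(w)` has a finite nontangential limit at `σ`-a.e. `z ∈ ∂D`. -/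
theorem stmt_7
    (d : ℕ) (hd : 2 ≤ d)
    (D : Set (EuclideanSpace ℝ (Fin d)))
    (hD_open : IsOpen D) (hD_bdd : Bornology.IsBounded D)
    (M : EuclideanSpace ℝ (Fin d) → EuclideanSpace ℝ (Fin d) → ℝ)
    (hM_meas : ∀ x, Measurable fun w => M x w)
    (c₁ c₂ : ℝ) (hc₁ : 0 < c₁) (hc₁₂ : c₁ ≤ c₂)
    (hM_lb : ∀ x ∈ D, ∀ w ∈ frontier D,
      c₁ * infDist x Dᶜ / dist x w ^ d ≤ M x w)
    (hM_ub : ∀ x ∈ D, ∀ w ∈ frontier D,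
      M x w ≤ c₂ * infDist x Dᶜ / dist x w ^ d)
    (σ : Measure (EuclideanSpace ℝ (Fin d))) [IsFiniteMeasure σ]
    (hσ_supp : σ (frontier D)ᶜ = 0)
    (C₁ C₂ R₁ : ℝ) (hC₁ : 0 < C₁) (hC₁₂ : C₁ ≤ C₂) (hR₁ : 0 < R₁)
    (hAhlfors_lb : ∀ z ∈ frontier D, ∀ r : ℝ, 0 < r → r ≤ R₁ →
      ENNReal.ofReal (C₁ * r ^ (d - 1)) ≤ σ (frontier D ∩ ball z r))
    (hAhlfors_ub : ∀ z ∈ frontier D, ∀ r : ℝ, 0 < r → r ≤ R₁ →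
      σ (frontier D ∩ ball z r) ≤ ENNReal.ofReal (C₂ * r ^ (d - 1)))
    (s : EuclideanSpace ℝ (Fin d) → ℝ) (hs_meas : Measurable s)
    (a b : ℝ) (ha : 0 < a) (hab : a ≤ b)
    (hs : ∀ w ∈ frontier D, a ≤ s w ∧ s w ≤ b)
    (F : EuclideanSpace ℝ (Fin d) → ℝ)
    (hF : ∀ x, F x = ∫ w in frontier D, M x w * s w ∂σ)
    (hF_lim : ∀ z ∈ frontier D, Tendsto F (𝓝[D] z) (𝓝 1)) :
    ∀ (μ : Measure (EuclideanSpace ℝ (Fin d))), IsFiniteMeasure μ →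
      μ (frontier D)ᶜ = 0 →
      ∀ β : ℝ, 1 < β →
        ∀ᵐ z ∂σ, ∃ L : ℝ,
          Tendsto (fun x => ∫ w in frontier D, M x w ∂μ)
            (𝓝[{x ∈ D | dist x z < β * infDist x Dᶜ}] z) (𝓝 L) := by
  intro μ₀ _ _ β hβ
  obtain ⟨n, rfl⟩ : ∃ n, d = n + 1 := ⟨d - 1, by omega⟩
  simp only [Nat.add_sub_cancel] at hAhlfors_ub
  have hfr : MeasurableSet (frontier D) := isClosed_frontier.measurableSet
  have hfrD : ∀ w ∈ frontier D, w ∈ Dᶜ := fun w hw hwD => by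
    rw [hD_open.frontier_eq] at hw
    exact hw.2 hwD
  set μ := μ₀.restrict (frontier D)
  set σ' := σ.restrict (frontier D) with hσ'
  have hσσ' : σ' = σ := Measure.restrict_eq_self_of_ae_mem (by rwa [ae_iff])
  have hmem : ∀ᵐ w ∂σ', w ∈ frontier D := ae_restrict_mem hfr
  have hsm : Measurable fun w => ENNReal.ofReal (s w) := hs_meas.ennreal_ofReal
  set ν := σ'.withDensity fun w => ENNReal.ofReal (s w) with hν
  have hac : ν ≪ σ' := withDensity_absolutelyContinuous _ _
  have hac' : σ' ≪ ν := by
    refine withDensity_absolutelyContinuous' hsm.aemeasurable ?_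
    filter_upwards [hmem] with w hw
    simpa using ha.trans_le (hs w hw).1
  have hν_le : ∀ A, MeasurableSet A → ν A ≤ ENNReal.ofReal b * σ' A := by
    intro A hA
    rw [hν, withDensity_apply _ hA, ← setLIntegral_const]
    refine lintegral_mono_ae (ae_restrict_of_ae ?_)
    filter_upwards [hmem] with w hw using ENNReal.ofReal_le_ofReal (hs w hw).2
  have : IsFiniteMeasure ν := ⟨(hν_le univ MeasurableSet.univ).trans_lt
    (ENNReal.mul_lt_top ENNReal.ofReal_lt_top (measure_lt_top _ _))⟩
  have hνreg : ∀ᵐ z ∂ν, ∀ᶠ r in 𝓝[>] (0 : ℝ), ν (closedBall z r) ≤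
      (ENNReal.ofReal b * ENNReal.ofReal (C₂ * 2 ^ n)) * ENNReal.ofReal (r ^ n) := by
    filter_upwards [hac.ae_le hmem] with z hz
    filter_upwards [Ioc_mem_nhdsGT (half_pos hR₁)] with r hr
    have hr0 : 0 < r := hr.1
    rw [mul_assoc, ← ENNReal.ofReal_mul (by have := hC₁.trans_le hC₁₂; positivity)]
    refine (hν_le _ measurableSet_closedBall).trans (mul_le_mul_right ?_ _)
    rw [hσ', Measure.restrict_apply measurableSet_closedBall, inter_comm]
    calc σ (frontier D ∩ closedBall z r) ≤ σ (frontier D ∩ ball z (2 * r)) :=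
          measure_mono (inter_subset_inter_right _ (closedBall_subset_ball (by linarith)))
      _ ≤ ENNReal.ofReal (C₂ * (2 * r) ^ n) :=
          hAhlfors_ub z hz _ (by linarith) (by linarith [hr.2])
      _ = _ := by rw [mul_pow, mul_assoc]
  have hmain := hac'.ae_le (ae_tendsto_deviationMeasure_div_pow μ ν n
    (ENNReal.mul_ne_top ENNReal.ofReal_ne_top ENNReal.ofReal_ne_top) hνreg)
  rw [← hσσ']
  filter_upwards [hmain, hmem] with z hz hzD
  set L := (μ.rnDeriv ν z).toReal
  have hne : (Dᶜ).Nonempty := ⟨z, hfrD z hzD⟩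
  have hδpos : ∀ x ∈ D, 0 < infDist x Dᶜ := fun x hx =>
    (hD_open.isClosed_compl.notMem_iff_infDist_pos hne).1 (by simpa using hx)
  have hδle : ∀ x, ∀ w ∈ frontier D, infDist x Dᶜ ≤ dist x w := fun x w hw =>
    infDist_le_dist_of_mem (hfrD w hw)
  have hMnn : ∀ x ∈ D, ∀ w ∈ frontier D, 0 ≤ M x w := fun x hx w hw => by
    have := (hδpos x hx).le
    exact le_trans (by positivity) (hM_lb x hx w hw)
  have hc₂ : 0 < c₂ := hc₁.trans_le hc₁₂
  have hMbdd : ∀ x ∈ D, ∀ w ∈ frontier D, ‖M x w‖ ≤ c₂ * infDist x Dᶜ / infDist x Dᶜ ^ (n + 1) := by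
    intro x hx w hw
    have := hδpos x hx
    rw [Real.norm_of_nonneg (hMnn x hx w hw)]
    refine (hM_ub x hx w hw).trans ?_
    gcongr
    exact hδle x w hw
  have hint : ∀ x ∈ D, ∀ (ρ : Measure (EuclideanSpace ℝ (Fin (n + 1)))) [IsFiniteMeasure ρ],
      (∀ᵐ w ∂ρ, w ∈ frontier D) → Integrable (M x) ρ := by
    intro x hx ρ _ hρ
    refine Integrable.of_bound (hM_meas x).aestronglyMeasurable _ (hρ.mono (hMbdd x hx))
  have hFν : ∀ x, F x = ∫ w, M x w ∂ν := by
    intro x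
    rw [hF, hν, integral_withDensity_eq_integral_toReal_smul hsm (by simp)]
    refine integral_congr_ae ?_
    filter_upwards [hmem] with w hw
    rw [ENNReal.toReal_ofReal (ha.le.trans (hs w hw).1), smul_eq_mul, mul_comm]
  set τ := deviationMeasure μ ν L
  have hτmem : ∀ᵐ w ∂τ, w ∈ frontier D := by
    refine ae_add_measure_iff.2 ⟨?_, ?_⟩
    · exact (Measure.absolutelyContinuous_of_le (Measure.singularPart_le μ ν)).ae_le
        (ae_restrict_mem hfr)
    · exact (withDensity_absolutelyContinuous _ _).ae_le (hac.ae_le hmem)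
  set A := {x ∈ D | dist x z < β * infDist x Dᶜ}
  have hA_D : 𝓝[A] z ≤ 𝓝[D] z := nhdsWithin_mono _ (sep_subset _ _)
  have hδ : Tendsto (fun x => infDist x Dᶜ) (𝓝[A] z) (𝓝[>] 0) := by
    refine tendsto_nhdsWithin_iff.2 ⟨?_, ?_⟩
    · rw [← infDist_zero_of_mem (hfrD z hzD)]
      exact ((continuous_infDist_pt _).tendsto z).mono_left nhdsWithin_le_nhds
    · filter_upwards [self_mem_nhdsWithin] with x hx using hδpos x hx.1
  have hI := ENNReal.Tendsto.const_mul ((tendsto_lintegral_div_max_pow n τ z hz).comp hδ)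
    (Or.inr (ENNReal.ofReal_ne_top (r := c₂ * (1 + β) ^ (n + 1))))
  rw [mul_zero] at hI
  have hdiff : Tendsto (fun x => ∫ w, M x w ∂μ - L * F x) (𝓝[A] z) (𝓝 0) := by
    rw [tendsto_zero_iff_enorm_tendsto_zero]
    refine tendsto_of_tendsto_of_tendsto_of_le_of_le' tendsto_const_nhds hI
      (Eventually.of_forall fun _ => zero_le) ?_
    filter_upwards [self_mem_nhdsWithin] with x hx
    have hδx := hδpos x hx.1
    rw [hFν]
    refine (enorm_integral_sub_const_mul_le μ ν L (hM_meas x)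
      (hint x hx.1 μ (ae_restrict_mem hfr)) (hint x hx.1 ν (hac.ae_le hmem))).trans ?_
    rw [Function.comp_apply, ← lintegral_const_mul _ (by fun_prop)]
    refine lintegral_mono_ae ?_
    filter_upwards [hτmem] with w hw
    rw [Real.enorm_of_nonneg (hMnn x hx.1 w hw), ← ENNReal.ofReal_mul (by positivity)]
    refine ENNReal.ofReal_le_ofReal ((hM_ub x hx.1 w hw).trans ?_)
    have hxw := hδle x w hw
    have hmax : max (infDist x Dᶜ) (dist w z) ≤ (1 + β) * dist x w := by
      refine max_le (by nlinarith) ?_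
      have h1 : dist w z ≤ dist x w + dist x z := by
        rw [dist_comm x w]
        exact dist_triangle _ _ _
      have h2 := hx.2
      nlinarith
    have hmax0 : 0 < max (infDist x Dᶜ) (dist w z) := lt_max_of_lt_left hδx
    have hxw0 : 0 < dist x w := hδx.trans_le hxw
    calc c₂ * infDist x Dᶜ / dist x w ^ (n + 1)
        = c₂ * (1 + β) ^ (n + 1) * (infDist x Dᶜ / ((1 + β) * dist x w) ^ (n + 1)) := by
          rw [mul_pow]
          field_simp
      _ ≤ _ := by gcongr
  refine ⟨L, ?_⟩
  have := hdiff.add (((hF_lim z hzD).mono_left hA_D).const_mul L)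
  simpa using this
end

section
/- For all real numbers a > 0 and r > 0, the Lebesgue integral over the disc B(0,r) ⊂ ℝ² satisfies ∫_{B(0,r)} ln(1 + a²/|v|²) dv = π r² ln(1 + a²/r²) + π a² ln(1 + r²/a²). -/
open MeasureTheory Metric Filter Topology Set

/-- Integration of a radial function over a ball centred at the origin of the plane,
in polar coordinates. -/
theorem setIntegral_ball_fun_norm_euclideanSpace_fin_two (f : ℝ → ℝ) {r : ℝ} (hr : 0 ≤ r) :
    ∫ v in ball (0 : EuclideanSpace ℝ (Fin 2)) r, f ‖v‖ =
      2 * Real.pi * ∫ y in (0 : ℝ)..r, y * f y := by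
  have hball : (volume : Measure (EuclideanSpace ℝ (Fin 2))).real (ball 0 1) = Real.pi := by
    simp [Measure.real, EuclideanSpace.volume_ball_fin_two, Real.pi_pos.le]
  calc
    _ = ∫ v : EuclideanSpace ℝ (Fin 2), (Iio r).indicator f ‖v‖ := by
      rw [← integral_indicator measurableSet_ball]
      congr 1 with v
      simp [indicator]
    _ = 2 * Real.pi * ∫ y in Ioi (0 : ℝ), y * (Iio r).indicator f y := by
      rw [integral_fun_norm_addHaar volume, hball]
      simp [mul_assoc]
    _ = _ := by
      rw [intervalIntegral.integral_of_le hr, integral_Ioc_eq_integral_Ioo,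
        ← Ioi_inter_Iio, ← setIntegral_indicator measurableSet_Iio]
      simp only [indicator_mul_right]

/-- A radial antiderivative for the logarithmic kernel. -/
theorem integral_mul_log_one_add_sq_div_sq {a r : ℝ} (ha : 0 < a) (hr : 0 < r) :
    ∫ y in (0 : ℝ)..r, y * Real.log (1 + a ^ 2 / y ^ 2) =
      (r ^ 2 * Real.log (1 + a ^ 2 / r ^ 2) + a ^ 2 * Real.log (1 + r ^ 2 / a ^ 2)) / 2 := by
  have hlog : ∀ {x y : ℝ}, 0 < x → 0 < y →
      Real.log (1 + x ^ 2 / y ^ 2) = Real.log (y ^ 2 + x ^ 2) - Real.log (y ^ 2) := by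
    intro x y hx hy
    rw [← Real.log_div (by positivity) (by positivity)]
    congr 1
    field_simp
  set G : ℝ → ℝ := fun y ↦
    ((y ^ 2 + a ^ 2) * Real.log (y ^ 2 + a ^ 2) - y ^ 2 * Real.log (y ^ 2)) / 2 with hG
  have hcont : Continuous G :=
    ((Real.continuous_mul_log.comp (by fun_prop : Continuous fun y : ℝ ↦ y ^ 2 + a ^ 2)).sub
      (Real.continuous_mul_log.comp (by fun_prop : Continuous fun y : ℝ ↦ y ^ 2))).div_const 2
  have hderiv : ∀ y ∈ Ioo 0 r, HasDerivAt G (y * Real.log (1 + a ^ 2 / y ^ 2)) y := by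
    intro y hy
    have hy0 : 0 < y := hy.1
    have hsq : HasDerivAt (fun y : ℝ ↦ y ^ 2) (2 * y) y := by simpa using hasDerivAt_pow 2 y
    have h₁ := (Real.hasDerivAt_mul_log (x := y ^ 2 + a ^ 2) (by positivity)).comp y
      (hsq.add_const (a ^ 2))
    have h₂ := (Real.hasDerivAt_mul_log (x := y ^ 2) (by positivity)).comp y hsq
    refine ((h₁.sub h₂).div_const 2).congr_deriv ?_
    rw [hlog ha hy0]
    ring
  have hint : IntervalIntegrable (fun y ↦ y * Real.log (1 + a ^ 2 / y ^ 2)) volume 0 r := by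
    rw [intervalIntegrable_iff_integrableOn_Ioc_of_le hr.le]
    refine intervalIntegral.integrableOn_deriv_of_nonneg hcont.continuousOn hderiv ?_
    intro y hy
    exact mul_nonneg hy.1.le (Real.log_nonneg (le_add_of_nonneg_right (by positivity)))
  rw [intervalIntegral.integral_eq_sub_of_hasDerivAt_of_le hr.le hcont.continuousOn hderiv hint,
    hlog ha hr, hlog hr ha, add_comm (a ^ 2) (r ^ 2)]
  simp [hG]
  ring

/-- An explicit logarithmic integral over a planar disc.
For all `a > 0` and `r > 0`, the Lebesgue integral over the disc `B(0,r) ⊂ ℝ²`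
satisfies
`∫_{B(0,r)} ln(1 + a²/|v|²) dv = π r² ln(1 + a²/r²) + π a² ln(1 + r²/a²)`. -/
theorem stmt_13 (a r : ℝ) (ha : 0 < a) (hr : 0 < r) :
    ∫ v in Metric.ball (0 : EuclideanSpace ℝ (Fin 2)) r,
        Real.log (1 + a ^ 2 / ‖v‖ ^ 2) =
      Real.pi * r ^ 2 * Real.log (1 + a ^ 2 / r ^ 2)
        + Real.pi * a ^ 2 * Real.log (1 + r ^ 2 / a ^ 2) := by
  rw [setIntegral_ball_fun_norm_euclideanSpace_fin_two
      (fun y ↦ Real.log (1 + a ^ 2 / y ^ 2)) hr.le,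
    integral_mul_log_one_add_sq_div_sq ha hr]
  ring
end

section
/- Let D ⊊ ℝ² be a nonempty open set with nonempty complement and δ_D(x) = dist(x, ℝ² ∖ D). Let λ ∈ (0, 1/2), y ∈ D, and let w ∈ ℝ² satisfy |w − y| ≤ λ δ_D(y). Then ∫_{B(y, λ δ_D(y))} ln(1 + δ_D(w) δ_D(v) / |w − v|²) dv ≤ C(λ) δ_D(y)², where one may take C(λ) = 4πλ² ln(1 + (1+λ)²/(4λ²)) + π(1+λ)² ln(1 + 4λ²/(1+λ)²). -/
open MeasureTheory Metric Filter Topology Set Real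

lemma hasDerivAt_primitive {A r : ℝ} (hr : 0 < r) :
    HasDerivAt (fun r : ℝ => ((r ^ 2 + A ^ 2) * log (r ^ 2 + A ^ 2) - r ^ 2 * log (r ^ 2)) / 2)
      (r * log (1 + A ^ 2 / r ^ 2)) r := by
  have h1 : HasDerivAt (fun r : ℝ => r ^ 2) (2 * r) r := by simpa using hasDerivAt_pow 2 r
  have hA : 0 < r ^ 2 + A ^ 2 := by positivity
  have h2 := (Real.hasDerivAt_mul_log hA.ne').comp r (h1.add_const (A ^ 2))
  have h3 := HasDerivAt.comp (h := fun r : ℝ => r ^ 2) r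
    (Real.hasDerivAt_mul_log (x := r ^ 2) (pow_pos hr 2).ne') h1
  have h4 := (h2.sub h3).div_const 2
  refine h4.congr_deriv ?_
  have : 1 + A ^ 2 / r ^ 2 = (r ^ 2 + A ^ 2) / r ^ 2 := by field_simp
  rw [this, log_div hA.ne' (pow_pos hr 2).ne']
  ring

lemma continuous_primitive (A : ℝ) :
    Continuous
      (fun r : ℝ => ((r ^ 2 + A ^ 2) * log (r ^ 2 + A ^ 2) - r ^ 2 * log (r ^ 2)) / 2) := by
  have h1 : Continuous (fun r : ℝ => (r ^ 2 + A ^ 2) * log (r ^ 2 + A ^ 2)) :=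
    Real.continuous_mul_log.comp (by fun_prop : Continuous (fun r : ℝ => r ^ 2 + A ^ 2))
  have h2 : Continuous (fun r : ℝ => r ^ 2 * log (r ^ 2)) :=
    Real.continuous_mul_log.comp (by fun_prop : Continuous (fun r : ℝ => r ^ 2))
  exact (h1.sub h2).div_const 2

lemma log_one_add_div_nonneg (A r : ℝ) : 0 ≤ log (1 + A ^ 2 / r ^ 2) :=
  log_nonneg (by have : 0 ≤ A ^ 2 / r ^ 2 := by positivity
                 linarith)

lemma intervalIntegrable_mul_log {A R : ℝ} (hR : 0 < R) :
    IntervalIntegrable (fun r => r * log (1 + A ^ 2 / r ^ 2)) volume 0 R := by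
  refine intervalIntegral.intervalIntegrable_deriv_of_nonneg
    (continuous_primitive A).continuousOn (fun r hr => ?_) (fun r hr => ?_)
  · exact hasDerivAt_primitive (by simpa [hR.le] using hr.1)
  · have : 0 < r := by simpa [hR.le] using hr.1
    exact mul_nonneg this.le (log_one_add_div_nonneg A r)

lemma intervalIntegral_mul_log {A R : ℝ} (hA : 0 < A) (hR : 0 < R) :
    ∫ r in (0 : ℝ)..R, r * log (1 + A ^ 2 / r ^ 2) =
      (R ^ 2 * log (1 + A ^ 2 / R ^ 2) + A ^ 2 * log (1 + R ^ 2 / A ^ 2)) / 2 := by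
  rw [intervalIntegral.integral_eq_sub_of_hasDerivAt_of_le hR.le
    (continuous_primitive A).continuousOn (fun r hr => hasDerivAt_primitive hr.1)
    (intervalIntegrable_mul_log hR)]
  have h1 : 1 + A ^ 2 / R ^ 2 = (R ^ 2 + A ^ 2) / R ^ 2 := by field_simp
  have h2 : 1 + R ^ 2 / A ^ 2 = (R ^ 2 + A ^ 2) / A ^ 2 := by field_simp; ring
  rw [h1, h2, log_div (by positivity) (by positivity), log_div (by positivity) (by positivity)]
  simp
  ring

lemma integrable_indicator_log {A R : ℝ} (hR : 0 < R) :
    Integrable (fun x : EuclideanSpace ℝ (Fin 2) =>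
      (Iic R).indicator (fun r => log (1 + A ^ 2 / r ^ 2)) ‖x‖) := by
  rw [integrable_fun_norm_addHaar volume
    (f := (Iic R).indicator (fun r => log (1 + A ^ 2 / r ^ 2)))]
  have h := (intervalIntegrable_iff_integrableOn_Ioc_of_le hR.le).1
    (intervalIntegrable_mul_log (A := A) hR)
  have h2 := (integrable_indicator_iff measurableSet_Iic).2
    (show IntegrableOn (fun r => r * log (1 + A ^ 2 / r ^ 2)) (Iic R)
        (volume.restrict (Ioi (0 : ℝ))) by
      rwa [IntegrableOn, Measure.restrict_restrict measurableSet_Iic, Iic_inter_Ioi])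
  refine h2.congr (Eventually.of_forall fun r => ?_)
  by_cases hr : r ≤ R <;> simp [indicator, hr]

lemma integral_indicator_log {A R : ℝ} (hA : 0 < A) (hR : 0 < R) :
    ∫ x : EuclideanSpace ℝ (Fin 2), (Iic R).indicator (fun r => log (1 + A ^ 2 / r ^ 2)) ‖x‖ =
      π * (R ^ 2 * log (1 + A ^ 2 / R ^ 2) + A ^ 2 * log (1 + R ^ 2 / A ^ 2)) := by
  rw [integral_fun_norm_addHaar volume ((Iic R).indicator (fun r => log (1 + A ^ 2 / r ^ 2)))]
  have h1 : ∫ r in Ioi (0 : ℝ), r ^ (Module.finrank ℝ (EuclideanSpace ℝ (Fin 2)) - 1) •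
      (Iic R).indicator (fun r => log (1 + A ^ 2 / r ^ 2)) r =
      ∫ r in (0 : ℝ)..R, r * log (1 + A ^ 2 / r ^ 2) := by
    rw [intervalIntegral.integral_of_le hR.le, ← Iic_inter_Ioi,
      ← Measure.restrict_restrict measurableSet_Iic, ← integral_indicator measurableSet_Iic]
    refine integral_congr_ae (Eventually.of_forall fun r => ?_)
    by_cases hr : r ≤ R <;> simp [indicator, hr]
  rw [h1, intervalIntegral_mul_log hA hR]
  have h2 : volume.real (ball (0 : EuclideanSpace ℝ (Fin 2)) 1) = π := by
    simp [measureReal_def, EuclideanSpace.volume_ball_fin_two, pi_pos.le]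
  rw [h2]
  simp
  ring

/-- A logarithmic integral bound on discs in the plane.
Let `D ⊊ ℝ²` be a nonempty open set with nonempty complement and
`δ_D(x) = dist(x, ℝ² ∖ D)`.  Let `λ ∈ (0,1/2)`, `y ∈ D` and `w ∈ ℝ²` with
`|w − y| ≤ λ δ_D(y)`.  Then
`∫_{B(y, λδ_D(y))} ln(1 + δ_D(w)δ_D(v)/|w−v|²) dv ≤ C(λ) δ_D(y)²` with
`C(λ) = 4πλ² ln(1 + (1+λ)²/(4λ²)) + π(1+λ)² ln(1 + 4λ²/(1+λ)²)`. -/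
theorem stmt_14
    (D : Set (EuclideanSpace ℝ (Fin 2)))
    (hD_open : IsOpen D) (hD_ne : D.Nonempty) (hDc_ne : Dᶜ.Nonempty)
    (lam : ℝ) (hlam0 : 0 < lam) (hlam : lam < 1 / 2)
    (y w : EuclideanSpace ℝ (Fin 2)) (hy : y ∈ D)
    (hw : dist w y ≤ lam * infDist y Dᶜ) :
    ∫ v in Metric.ball y (lam * infDist y Dᶜ),
        Real.log (1 + infDist w Dᶜ * infDist v Dᶜ / dist w v ^ 2) ≤
      (4 * π * lam ^ 2 * Real.log (1 + (1 + lam) ^ 2 / (4 * lam ^ 2))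
          + π * (1 + lam) ^ 2 * Real.log (1 + 4 * lam ^ 2 / (1 + lam) ^ 2))
        * infDist y Dᶜ ^ 2 := by
  have hd : 0 < infDist y Dᶜ :=
    (hD_open.isClosed_compl.notMem_iff_infDist_pos hDc_ne).1 (by simpa using hy)
  set d := infDist y Dᶜ
  have hA : 0 < (1 + lam) * d := by positivity
  have hR : 0 < 2 * lam * d := by positivity
  have key := integral_indicator_log hA hR
  have hint := integrable_indicator_log (A := (1 + lam) * d) hR
  set f : ℝ → ℝ := (Iic (2 * lam * d)).indicator
    (fun r => log (1 + ((1 + lam) * d) ^ 2 / r ^ 2)) with hf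
  have hf0 : ∀ r, 0 ≤ f r := indicator_nonneg fun r _ => log_one_add_div_nonneg _ r
  have hle : ∀ v, dist v y ≤ lam * d → infDist v Dᶜ ≤ (1 + lam) * d := fun v hv => by
    have := infDist_le_infDist_add_dist (s := Dᶜ) (x := v) (y := y)
    linarith
  have hquot : ∀ v, 0 ≤ infDist w Dᶜ * infDist v Dᶜ / dist w v ^ 2 := fun v =>
    div_nonneg (mul_nonneg infDist_nonneg infDist_nonneg) (sq_nonneg _)
  have hint' : Integrable (fun v => f ‖v - w‖) := hint.comp_sub_right w
  calc
    _ ≤ ∫ v in ball y (lam * d), f ‖v - w‖ := by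
      refine integral_mono_of_nonneg
        (Eventually.of_forall fun v => log_nonneg (by linarith [hquot v])) hint'.integrableOn ?_
      refine (ae_restrict_iff' measurableSet_ball).2 (Eventually.of_forall fun v hv => ?_)
      have hv : dist v y < lam * d := hv
      have hvw : dist w v ≤ 2 * lam * d := by
        have := dist_triangle_right w v y
        linarith
      beta_reduce
      rw [← dist_eq_norm, dist_comm v w, hf, indicator_of_mem (mem_Iic.2 hvw)]
      refine log_le_log (by linarith [hquot v]) ?_
      have := mul_le_mul (hle w hw) (hle v hv.le) infDist_nonneg hA.le
      rw [← sq] at this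
      gcongr
    _ ≤ ∫ v, f ‖v - w‖ :=
      setIntegral_le_integral hint' (Eventually.of_forall fun v => hf0 _)
    _ = ∫ v : EuclideanSpace ℝ (Fin 2), f ‖v‖ :=
      integral_sub_right_eq_self (fun v => f ‖v‖) w
    _ = _ := by
      rw [key]
      have h1 : ((1 + lam) * d) ^ 2 / (2 * lam * d) ^ 2 = (1 + lam) ^ 2 / (4 * lam ^ 2) := by
        field_simp; norm_num
      have h2 : (2 * lam * d) ^ 2 / ((1 + lam) * d) ^ 2 = 4 * lam ^ 2 / (1 + lam) ^ 2 := by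
        field_simp; norm_num
      rw [h1, h2]
      ring
end
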